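/- Let A and D be computably enumerable sets, neither of which is K-trivial. Then there exists a computably enumerable set B such that B <_K A, B <_K D, and B is Turing equivalent to the halting problem ∅′. -/

import Mathlib

open Part Filter

open scoped Classical

namespace KPaper

/-- Binary strings. -/
abbrev Str := List Bool

/-! ### Oracle (Turing) reducibility -/

/-- The functions `ℕ →. ℕ` that are partial recursive relative to an oracle `O : ℕ →. ℕ`.
This mirrors Mathlib's `Nat.Partrec`, with an extra base case for the oracle. -/
inductive RecursiveIn (O : ℕ →. ℕ) : (ℕ →. ℕ) → Prop
  | oracle : RecursiveIn O O
  | zero : RecursiveIn O (pure 0)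
  | succ : RecursiveIn O ↑Nat.succ
  | left : RecursiveIn O ↑fun n : ℕ => n.unpair.1
  | right : RecursiveIn O ↑fun n : ℕ => n.unpair.2
  | pair {f g} : RecursiveIn O f → RecursiveIn O g →
      RecursiveIn O fun n => Nat.pair <$> f n <*> g n
  | comp {f g} : RecursiveIn O f → RecursiveIn O g → RecursiveIn O fun n => g n >>= f
  | prec {f g} : RecursiveIn O f → RecursiveIn O g → RecursiveIn O (Nat.unpaired fun a n =>
      n.rec (f a) fun y IH => do let i ← IH; g (Nat.pair a (Nat.pair y i)))
  | rfind {f} : RecursiveIn O f →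
      RecursiveIn O fun a => Nat.rfind fun n => (fun m => m = 0) <$> f (Nat.pair a n)

/-- The characteristic (partial) function of a set of naturals, used as a Turing oracle. -/
noncomputable def chi (A : Set ℕ) : ℕ →. ℕ := fun n => Part.some (if n ∈ A then 1 else 0)

/-- The characteristic function of an infinite binary sequence, used as a Turing oracle. -/
def chiSeq (X : ℕ → Bool) : ℕ →. ℕ := fun n => Part.some (cond (X n) 1 0)

/-- `A` is Turing reducible to `B`. -/
noncomputable def TuringLeSet (A B : Set ℕ) : Prop := RecursiveIn (chi B) (chi A)

/-- `A` is Turing equivalent to `B`. -/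
noncomputable def TuringEquivSet (A B : Set ℕ) : Prop := TuringLeSet A B ∧ TuringLeSet B A

/-- Turing equivalence between a set and an infinite binary sequence. -/
noncomputable def TuringEquivSetSeq (A : Set ℕ) (X : ℕ → Bool) : Prop :=
  RecursiveIn (chiSeq X) (chi A) ∧ RecursiveIn (chi A) (chiSeq X)

/-- The halting problem `∅'`. -/
def haltingSet : Set ℕ := {n | ((Denumerable.ofNat Nat.Partrec.Code n).eval n).Dom}

/-- A set of naturals is computably enumerable iff it is the domain of a
partial computable function. -/
def CESet (A : Set ℕ) : Prop := ∃ f : ℕ →. ℕ, Nat.Partrec f ∧ ∀ n, n ∈ A ↔ (f n).Dom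

/-! ### Machines and Kolmogorov complexity -/

/-- A (plain) machine is a partial computable map from binary strings to binary strings. -/
def PlainMachine (M : Str →. Str) : Prop := Partrec M

/-- A prefix-free machine: a partial computable map on binary strings whose
domain is an antichain under the prefix relation. -/
def PFMachine (M : Str →. Str) : Prop :=
  Partrec M ∧ ∀ ρ₁ ρ₂ : Str, (M ρ₁).Dom → (M ρ₂).Dom → ρ₁ <+: ρ₂ → ρ₁ = ρ₂

/-- The Kolmogorov complexity of a string `σ` with respect to a machine `M`:
the least length of an `M`-description of `σ` (`⊤` if there is none). -/
noncomputable def KC (M : Str →. Str) (σ : Str) : ℕ∞ :=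
  ⨅ ρ : {ρ : Str // σ ∈ M ρ}, ((ρ : Str).length : ℕ∞)

/-- An optimal prefix-free machine: a prefix-free machine whose associated complexity
is minimal, up to an additive constant, among all prefix-free machines. -/
def OptimalPF (U : Str →. Str) : Prop :=
  PFMachine U ∧ ∀ M : Str →. Str, PFMachine M → ∃ c : ℕ, ∀ σ : Str, KC U σ ≤ KC M σ + c

/-- An optimal plain machine. -/
def OptimalPlain (V : Str →. Str) : Prop :=
  PlainMachine V ∧ ∀ M : Str →. Str, PlainMachine M → ∃ c : ℕ, ∀ σ : Str, KC V σ ≤ KC M σ + c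

/-! ### Initial segments -/

/-- The first `n` bits of the characteristic sequence of a set of naturals. -/
noncomputable def restrSet (A : Set ℕ) (n : ℕ) : Str :=
  (List.range n).map fun i => decide (i ∈ A)

/-- The first `n` bits of an infinite binary sequence. -/
def restrSeq (X : ℕ → Bool) (n : ℕ) : Str := (List.range n).map X

/-- The string `0^n`; `K(n)` is identified with `K(0^n)`. -/
def zeroStr (n : ℕ) : Str := List.replicate n false

/-! ### `≤_K`, `<_K`, `K`-triviality (and the `≤_C` analogues) -/

def KLeSet (U : Str →. Str) (A B : Set ℕ) : Prop :=
  ∃ c : ℕ, ∀ n, KC U (restrSet A n) ≤ KC U (restrSet B n) + c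

def KLtSet (U : Str →. Str) (A B : Set ℕ) : Prop := KLeSet U A B ∧ ¬ KLeSet U B A

def KTrivialSet (U : Str →. Str) (A : Set ℕ) : Prop :=
  ∃ c : ℕ, ∀ n, KC U (restrSet A n) ≤ KC U (zeroStr n) + c

def KLeSeq (U : Str →. Str) (X Y : ℕ → Bool) : Prop :=
  ∃ c : ℕ, ∀ n, KC U (restrSeq X n) ≤ KC U (restrSeq Y n) + c

def KLtSeq (U : Str →. Str) (X Y : ℕ → Bool) : Prop := KLeSeq U X Y ∧ ¬ KLeSeq U Y X

def KTrivialSeq (U : Str →. Str) (X : ℕ → Bool) : Prop :=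
  ∃ c : ℕ, ∀ n, KC U (restrSeq X n) ≤ KC U (zeroStr n) + c

/-! ### Computably enumerable reals -/

/-- The real number in `[0,1]` whose binary expansion is the sequence `X`. -/
noncomputable def realOfSeq (X : ℕ → Bool) : ℝ := ∑' i : ℕ, cond (X i) ((2 : ℝ) ^ (i + 1))⁻¹ 0

/-- `X` (identified with the real it is the binary expansion of) is a computably
enumerable real: it is the limit of a nondecreasing computable sequence of
(dyadic) rationals. -/
def CEReal (X : ℕ → Bool) : Prop :=
  ∃ f : ℕ → ℤ, Computable f ∧
    (∀ s, (f s : ℝ) / 2 ^ s ≤ (f (s + 1) : ℝ) / 2 ^ (s + 1)) ∧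
    Tendsto (fun s => (f s : ℝ) / 2 ^ s) atTop (nhds (realOfSeq X))

/-- The characteristic sequence of a set of naturals. -/
noncomputable def seqOfSet (A : Set ℕ) : ℕ → Bool := fun i => decide (i ∈ A)

/-! ### Solovay reducibility -/

/-- Solovay reducibility on c.e. reals: `X ≤_S Y` iff there are nondecreasing computable
rational approximations to `X` and `Y` and a constant `c` such that at each stage the
distance to `X` is bounded by `c` times the distance to `Y`. -/
def SolovayLe (X Y : ℕ → Bool) : Prop :=
  ∃ (c : ℕ) (f g : ℕ → ℤ), Computable f ∧ Computable g ∧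
    (∀ s, (f s : ℝ) / 2 ^ s ≤ (f (s + 1) : ℝ) / 2 ^ (s + 1)) ∧
    (∀ s, (g s : ℝ) / 2 ^ s ≤ (g (s + 1) : ℝ) / 2 ^ (s + 1)) ∧
    Tendsto (fun s => (f s : ℝ) / 2 ^ s) atTop (nhds (realOfSeq X)) ∧
    Tendsto (fun s => (g s : ℝ) / 2 ^ s) atTop (nhds (realOfSeq Y)) ∧
    ∀ s, realOfSeq X - (f s : ℝ) / 2 ^ s ≤ (c : ℝ) * (realOfSeq Y - (g s : ℝ) / 2 ^ s)



/-! ### Part 1: the Kraft–Chaitin lemma -/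

/-- value of a binary string -/
def bval (ρ : Str) : ℕ := ρ.foldl (fun v b => 2 * v + cond b 1 0) 0

theorem bval_foldl (τ : Str) : ∀ a : ℕ, τ.foldl (fun v b => 2 * v + cond b 1 0) a
    = a * 2 ^ τ.length + bval τ := by
  induction τ with
  | nil => intro a; simp [bval]
  | cons b τ ih =>
    intro a
    simp only [List.foldl_cons, List.length_cons, bval]
    rw [ih, ih]
    ring

theorem bval_append (ρ τ : Str) : bval (ρ ++ τ) = bval ρ * 2 ^ τ.length + bval τ := by
  rw [bval, List.foldl_append, bval_foldl]; rfl

theorem bval_lt (τ : Str) : bval τ < 2 ^ τ.length := by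
  induction τ using List.reverseRecOn with
  | nil => simp [bval]
  | append_singleton τ b ih =>
    rw [bval_append]
    simp only [List.length_append, List.length_singleton, pow_succ, pow_zero, one_mul]
    have : bval [b] < 2 := by cases b <;> simp [bval]
    omega

theorem exists_bval : ∀ (n v : ℕ), v < 2 ^ n → ∃ ρ : Str, ρ.length = n ∧ bval ρ = v := by
  intro n
  induction n with
  | zero => intro v hv; exact ⟨[], rfl, by simp [bval]; simp at hv; exact hv.symm⟩
  | succ n ih =>
    intro v hv
    obtain ⟨ρ, h1, h2⟩ := ih (v / 2) (by rw [pow_succ] at hv; omega)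
    refine ⟨ρ ++ [decide (v % 2 = 1)], by simp [h1], ?_⟩
    rw [bval_append, h2]
    have : bval [decide (v % 2 = 1)] = v % 2 := by
      rcases Nat.mod_two_eq_zero_or_one v with h | h <;> simp [bval, h]
    rw [this]; simp; omega

theorem primrec_pow2 : Primrec (fun n : ℕ => 2 ^ n) := by
  have : Primrec (fun n : ℕ => Nat.rec (motive := fun _ => ℕ) 1 (fun _ v => 2 * v) n) :=
    Primrec.nat_rec' Primrec.id (Primrec.const 1)
      (Primrec.nat_mul.comp (Primrec.const 2) (Primrec.snd.comp Primrec.snd)).to₂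
  refine this.of_eq fun n => ?_
  induction n with
  | zero => rfl
  | succ n ih => simp only [pow_succ]; rw [← ih]; ring

theorem primrec_bval : Primrec bval := by
  refine Primrec.list_foldl (f := fun ρ : Str => ρ) (g := fun _ => 0)
    (h := fun _ (p : ℕ × Bool) => 2 * p.1 + cond p.2 1 0) Primrec.id (Primrec.const 0) ?_
  refine Primrec.nat_add.comp (Primrec.nat_mul.comp (Primrec.const 2) (Primrec.fst.comp Primrec.snd)) ?_
  exact Primrec.cond (Primrec.snd.comp Primrec.snd) (Primrec.const 1) (Primrec.const 0)

/-- weight of a length -/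
noncomputable def w2 (l : ℕ) : ℝ := (1 / 2 : ℝ) ^ l

theorem w2_pos (l : ℕ) : 0 < w2 l := by unfold w2; positivity
theorem w2_nonneg (l : ℕ) : 0 ≤ w2 l := (w2_pos l).le
theorem w2_le_one (l : ℕ) : w2 l ≤ 1 := by
  unfold w2; exact pow_le_one₀ (by norm_num) (by norm_num)
theorem w2_add (a b : ℕ) : w2 (a + b) = w2 a * w2 b := by unfold w2; exact pow_add _ _ _
theorem w2_mul_pow (a : ℕ) : w2 a * 2 ^ a = 1 := by
  unfold w2; rw [← mul_pow]; norm_num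
theorem w2_succ (a : ℕ) : w2 (a + 1) * 2 = w2 a := by
  unfold w2; rw [pow_succ]; ring
theorem w2_eq (a : ℕ) : w2 a = 1 / 2 ^ a := by
  unfold w2; rw [div_pow, one_pow]
theorem w2_anti {a b : ℕ} (h : a ≤ b) : w2 b ≤ w2 a :=
  pow_le_pow_of_le_one (by norm_num) (by norm_num) h

/-- weight of a request -/
noncomputable def rw2 : Option (ℕ × Str) → ℝ
  | Option.none => 0
  | Option.some q => w2 q.1

theorem rw2_nonneg (o : Option (ℕ × Str)) : 0 ≤ rw2 o := by
  cases o with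
  | none => exact le_rfl
  | some q => exact w2_nonneg _

/-- allocation state `(G, X)` representing the dyadic rational `X / 2 ^ G` -/
def kcSt (r : ℕ → Option (ℕ × Str)) : ℕ → ℕ × ℕ
  | 0 => (0, 0)
  | k + 1 => match r k with
    | Option.none => kcSt r k
    | Option.some q => ((kcSt r k).1 + q.1, (kcSt r k).2 * 2 ^ q.1 + 2 ^ (kcSt r k).1)

theorem kcSt_val (r : ℕ → Option (ℕ × Str)) (k : ℕ) :
    ((kcSt r k).2 : ℝ) / 2 ^ (kcSt r k).1 = ∑ j ∈ Finset.range k, rw2 (r j) := by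
  induction k with
  | zero => simp [kcSt]
  | succ k ih =>
    rw [Finset.sum_range_succ, ← ih]
    rcases h : r k with _ | q
    · simp [kcSt, h, rw2]
    · simp only [kcSt, h, rw2, w2_eq]
      push_cast
      rw [pow_add]
      field_simp

/-- the string (as a number) allotted to a request of length `l` at index `k` -/
def kcV (r : ℕ → Option (ℕ × Str)) (k l : ℕ) : ℕ :=
  ((kcSt r k).2 * 2 ^ (l + 1) + 2 ^ (kcSt r k).1 - 1) / 2 ^ (kcSt r k).1

theorem kcV_bounds (r : ℕ → Option (ℕ × Str)) (k l : ℕ) :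
    (∑ j ∈ Finset.range k, rw2 (r j)) ≤ (kcV r k l : ℝ) * w2 (l + 1) ∧
    ((kcV r k l : ℝ) + 1) * w2 (l + 1) ≤ (∑ j ∈ Finset.range k, rw2 (r j)) + w2 l := by
  rw [← kcSt_val]
  set G := (kcSt r k).1
  set X := (kcSt r k).2
  have hv : kcV r k l = (X * 2 ^ (l + 1) + 2 ^ G - 1) / 2 ^ G := rfl
  set v := kcV r k l
  have hG : 0 < 2 ^ G := by positivity
  have h1 : v * 2 ^ G ≤ X * 2 ^ (l + 1) + 2 ^ G - 1 := by
    rw [hv]; exact Nat.div_mul_le_self _ _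
  have h2 : X * 2 ^ (l + 1) + 2 ^ G - 1 < (v + 1) * 2 ^ G := by
    rw [hv]; exact (Nat.lt_mul_div_succ _ hG).trans_eq (mul_comm _ _)
  have h3 : v * 2 ^ G ≤ X * 2 ^ (l + 1) + 2 ^ G := by omega
  have h4 : X * 2 ^ (l + 1) ≤ v * 2 ^ G := by rw [add_mul] at h2; omega
  have h3' : (v : ℝ) * 2 ^ G ≤ X * 2 ^ (l + 1) + 2 ^ G := by exact_mod_cast h3
  have h4' : (X : ℝ) * 2 ^ (l + 1) ≤ v * 2 ^ G := by exact_mod_cast h4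
  have e1 : w2 l = 2 * w2 (l + 1) := by rw [← w2_succ]; ring
  rw [e1, w2_eq]
  have p1 : (0 : ℝ) < 2 ^ G := by positivity
  have p2 : (0 : ℝ) < 2 ^ (l + 1) := by positivity
  constructor
  · rw [mul_one_div, div_le_div_iff₀ p1 p2]; exact h4'
  · rw [mul_one_div, mul_one_div, div_add_div _ _ p1.ne' p2.ne', div_le_div_iff₀ p2 (by positivity)]
    nlinarith

/-- the Kraft–Chaitin machine test -/
def kcTest (r : ℕ → Option (ℕ × Str)) (ρ : Str) (k : ℕ) : Option Str :=
  (r k).bind fun q => if ρ.length = q.1 + 1 ∧ bval ρ = kcV r k q.1 then Option.some q.2 else Option.none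

theorem kcTest_some {r : ℕ → Option (ℕ × Str)} {ρ : Str} {k : ℕ} {σ : Str} :
    kcTest r ρ k = Option.some σ ↔
    ∃ l, r k = Option.some (l, σ) ∧ ρ.length = l + 1 ∧ bval ρ = kcV r k l := by
  unfold kcTest
  rw [Option.bind_eq_some_iff]
  constructor
  · rintro ⟨⟨l, σ'⟩, h1, h2⟩
    split_ifs at h2 with h
    simp at h2; subst h2
    exact ⟨l, h1, h.1, h.2⟩
  · rintro ⟨l, h1, h2, h3⟩
    refine ⟨(l, σ), h1, ?_⟩
    simp [h2, h3]

theorem kcTest_prefix {r : ℕ → Option (ℕ × Str)}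
    {ρ τ : Str} {k k' : ℕ} {σ σ' : Str} (h1 : kcTest r ρ k = Option.some σ)
    (h2 : kcTest r (ρ ++ τ) k' = Option.some σ') : k = k' ∧ τ = [] := by
  rw [kcTest_some] at h1 h2
  obtain ⟨l, hr, hl, hv⟩ := h1
  obtain ⟨l', hr', hl', hv'⟩ := h2
  have hmono : Monotone fun k => ∑ j ∈ Finset.range k, rw2 (r j) := by
    intro a b hab
    exact Finset.sum_le_sum_of_subset_of_nonneg (Finset.range_mono hab) fun _ _ _ => rw2_nonneg _
  have b := kcV_bounds r k l
  have b' := kcV_bounds r k' l'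
  rw [← hv] at b
  rw [← hv', ] at b'
  rw [← hl] at b
  rw [← hl'] at b'
  have s1 : (∑ j ∈ Finset.range (k+1), rw2 (r j)) = (∑ j ∈ Finset.range k, rw2 (r j)) + w2 l := by
    rw [Finset.sum_range_succ, hr]; rfl
  have s1' : (∑ j ∈ Finset.range (k'+1), rw2 (r j)) = (∑ j ∈ Finset.range k', rw2 (r j)) + w2 l' := by
    rw [Finset.sum_range_succ, hr']; rfl
  rw [← s1] at b
  rw [← s1'] at b'
  have hτ := bval_lt τ
  rw [bval_append, List.length_append] at b'
  have e : w2 (ρ.length + τ.length) = w2 ρ.length * w2 τ.length := w2_add _ _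
  rw [e] at b'
  have hτ' : (bval τ : ℝ) + 1 ≤ 2 ^ τ.length := by exact_mod_cast hτ
  have ee := w2_mul_pow τ.length
  have pτ := w2_pos τ.length
  have pρ := w2_pos ρ.length
  push_cast at b'
  have c1 : (bval ρ : ℝ) * w2 ρ.length ≤ ((bval ρ : ℝ) * 2 ^ τ.length + bval τ) * (w2 ρ.length * w2 τ.length) := by
    have : ((bval ρ : ℝ) * 2 ^ τ.length + bval τ) * (w2 ρ.length * w2 τ.length)
      = bval ρ * w2 ρ.length * (w2 τ.length * 2 ^ τ.length) + bval τ * (w2 ρ.length * w2 τ.length) := by ring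
    rw [this, ee]
    have : 0 ≤ (bval τ : ℝ) * (w2 ρ.length * w2 τ.length) := by positivity
    linarith
  have c2 : ((bval ρ : ℝ) * 2 ^ τ.length + bval τ + 1) * (w2 ρ.length * w2 τ.length) ≤ (bval ρ + 1) * w2 ρ.length := by
    have : ((bval ρ : ℝ) * 2 ^ τ.length + bval τ + 1) * (w2 ρ.length * w2 τ.length)
      = bval ρ * w2 ρ.length * (w2 τ.length * 2 ^ τ.length) + (bval τ + 1) * (w2 ρ.length * w2 τ.length) := by ring
    rw [this, ee]
    have : ((bval τ : ℝ) + 1) * (w2 ρ.length * w2 τ.length) ≤ 2 ^ τ.length * (w2 ρ.length * w2 τ.length) := by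
      gcongr
    have e2 : 2 ^ τ.length * (w2 ρ.length * w2 τ.length) = w2 ρ.length * (w2 τ.length * 2 ^ τ.length) := by ring
    rw [e2, ee] at this
    linarith
  have hk : k = k' := by
    have pp : 0 < w2 ρ.length * w2 τ.length := by positivity
    rcases lt_trichotomy k k' with h | h | h
    · have m : (∑ j ∈ Finset.range (k+1), rw2 (r j)) ≤ (∑ j ∈ Finset.range k', rw2 (r j)) := hmono h
      exfalso; nlinarith [b.1, b.2, b'.1, b'.2, c1, c2]
    · exact h
    · have m : (∑ j ∈ Finset.range (k'+1), rw2 (r j)) ≤ (∑ j ∈ Finset.range k, rw2 (r j)) := hmono h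
      exfalso; nlinarith [b.1, b.2, b'.1, b'.2, c1, c2]
  refine ⟨hk, ?_⟩
  subst hk
  rw [hr] at hr'
  simp at hr'
  rw [List.length_append] at hl'
  have : τ.length = 0 := by omega
  exact List.length_eq_zero_iff.1 this

theorem kcSt_computable {r : ℕ → Option (ℕ × Str)} (hr : Computable r) : Computable (kcSt r) := by
  have : Computable (fun k : ℕ => Nat.rec (motive := fun _ => ℕ × ℕ) (0, 0)
      (fun k s => Option.casesOn (motive := fun _ => ℕ × ℕ) (r k) s
        fun q => (s.1 + q.1, s.2 * 2 ^ q.1 + 2 ^ s.1)) k) := by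
    refine Computable.nat_rec (f := fun k : ℕ => k) (g := fun _ => ((0 : ℕ), (0 : ℕ)))
      (h := fun _ (p : ℕ × (ℕ × ℕ)) => Option.casesOn (motive := fun _ => ℕ × ℕ) (r p.1) p.2
        fun q => (p.2.1 + q.1, p.2.2 * 2 ^ q.1 + 2 ^ p.2.1)) Computable.id (Computable.const _) ?_
    refine Computable.option_casesOn (hr.comp (Computable.fst.comp Computable.snd))
      (Computable.snd.comp Computable.snd) ?_
    refine Primrec.to_comp ?_
    have hs : Primrec (fun x : (ℕ × (ℕ × (ℕ × ℕ))) × (ℕ × Str) => x.1.2.2) :=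
      Primrec.snd.comp (Primrec.snd.comp Primrec.fst)
    have hq : Primrec (fun x : (ℕ × (ℕ × (ℕ × ℕ))) × (ℕ × Str) => x.2.1) :=
      Primrec.fst.comp Primrec.snd
    exact Primrec.pair (Primrec.nat_add.comp (Primrec.fst.comp hs) hq)
      (Primrec.nat_add.comp (Primrec.nat_mul.comp (Primrec.snd.comp hs) (primrec_pow2.comp hq))
        (primrec_pow2.comp (Primrec.fst.comp hs)))
  refine this.of_eq fun k => ?_
  induction k with
  | zero => rfl
  | succ k ih =>
    simp only [kcSt]
    rw [ih]
    rcases r k with _ | q <;> rfl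

/-- the decision part of the machine -/
def kcDec (x : (ℕ × ℕ) × (Str × (ℕ × Str))) : Option Str :=
  if x.2.1.length = x.2.2.1 + 1 ∧ bval x.2.1 =
    (x.1.2 * 2 ^ (x.2.2.1 + 1) + 2 ^ x.1.1 - 1) / 2 ^ x.1.1 then Option.some x.2.2.2 else Option.none

theorem kcDec_primrec : Primrec kcDec := by
  have hG : Primrec (fun x : (ℕ × ℕ) × (Str × (ℕ × Str)) => x.1.1) := Primrec.fst.comp Primrec.fst
  have hX : Primrec (fun x : (ℕ × ℕ) × (Str × (ℕ × Str)) => x.1.2) := Primrec.snd.comp Primrec.fst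
  have hρ : Primrec (fun x : (ℕ × ℕ) × (Str × (ℕ × Str)) => x.2.1) := Primrec.fst.comp Primrec.snd
  have hl : Primrec (fun x : (ℕ × ℕ) × (Str × (ℕ × Str)) => x.2.2.1 + 1) :=
    Primrec.succ.comp (Primrec.fst.comp (Primrec.snd.comp Primrec.snd))
  have hσ : Primrec (fun x : (ℕ × ℕ) × (Str × (ℕ × Str)) => x.2.2.2) :=
    (Primrec.snd.comp (Primrec.snd.comp Primrec.snd))
  refine Primrec.ite (PrimrecPred.and (Primrec.eq.comp (Primrec.list_length.comp hρ) hl)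
    (Primrec.eq.comp (primrec_bval.comp hρ) ?_)) (Primrec.option_some.comp hσ) (Primrec.const Option.none)
  refine Primrec.nat_div.comp (Primrec.nat_sub.comp (Primrec.nat_add.comp
    (Primrec.nat_mul.comp hX (primrec_pow2.comp hl)) (primrec_pow2.comp hG)) (Primrec.const 1))
    (primrec_pow2.comp hG)

theorem kcTest_computable {r : ℕ → Option (ℕ × Str)} (hr : Computable r) :
    Computable₂ (kcTest r) := by
  have hst := kcSt_computable hr
  have : Computable (fun p : Str × ℕ => (r p.2).bind fun q => kcDec (kcSt r p.2, (p.1, q))) := by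
    refine Computable.option_bind (f := fun p : Str × ℕ => r p.2)
      (g := fun p q => kcDec (kcSt r p.2, (p.1, q))) (hr.comp Computable.snd) ?_
    exact kcDec_primrec.to_comp.comp (Computable.pair (hst.comp (Computable.snd.comp Computable.fst))
      (Computable.pair (Computable.fst.comp Computable.fst) Computable.snd))
  refine this.of_eq fun p => ?_
  rfl

/-- Kraft–Chaitin, weight at most one. -/
theorem kc_one {U : Str →. Str} (hU : OptimalPF U) {r : ℕ → Option (ℕ × Str)} (hr : Computable r)
    (hs : ∀ n, ∑ k ∈ Finset.range n, rw2 (r k) ≤ 1) :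
    ∃ c : ℕ, ∀ k l σ, r k = Option.some (l, σ) → KC U σ ≤ (l : ℕ∞) + c := by
  have hM : PFMachine (fun ρ => Nat.rfindOpt (kcTest r ρ)) := by
    refine ⟨Partrec.rfindOpt (kcTest_computable hr), ?_⟩
    rintro ρ₁ ρ₂ h1 h2 ⟨τ, rfl⟩
    rw [Nat.rfindOpt_dom] at h1 h2
    obtain ⟨k, σ, h1⟩ := h1
    obtain ⟨k', σ', h2⟩ := h2
    rw [(kcTest_prefix h1 h2).2]; simp
  obtain ⟨c, hc⟩ := hU.2 _ hM
  refine ⟨c + 1, fun k l σ hk => ?_⟩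
  have hb := kcV_bounds r k l
  have hlt : kcV r k l < 2 ^ (l + 1) := by
    have := hs (k + 1)
    rw [Finset.sum_range_succ, hk] at this
    have h2 : ((kcV r k l : ℝ) + 1) * w2 (l + 1) ≤ 1 := hb.2.trans this
    have h3 := w2_mul_pow (l + 1)
    have h4 := w2_pos (l + 1)
    have : ((kcV r k l : ℝ) + 1) ≤ 2 ^ (l + 1) := by
      by_contra h; push Not at h
      nlinarith
    exact_mod_cast this
  obtain ⟨ρ, hρ1, hρ2⟩ := exists_bval _ _ hlt
  have ht : kcTest r ρ k = Option.some σ := kcTest_some.2 ⟨l, hk, hρ1, hρ2⟩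
  have hmem : σ ∈ Nat.rfindOpt (kcTest r ρ) := by
    have hd : (Nat.rfindOpt (kcTest r ρ)).Dom := Nat.rfindOpt_dom.2 ⟨k, σ, ht⟩
    obtain ⟨σ', hσ'⟩ := Part.dom_iff_mem.1 hd
    obtain ⟨k', hk'⟩ := Nat.rfindOpt_spec hσ'
    have hk' : kcTest r ρ k' = Option.some σ' := hk'
    have := (kcTest_prefix (τ := []) ht (by rw [List.append_nil]; exact hk')).1
    subst this
    rw [ht] at hk'
    simp at hk'
    rw [hk']; exact hσ'
  have : KC (fun ρ => Nat.rfindOpt (kcTest r ρ)) σ ≤ ((l + 1 : ℕ) : ℕ∞) := by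
    unfold KC
    rw [← hρ1]
    exact iInf_le (fun ρ : {ρ : Str // σ ∈ Nat.rfindOpt (kcTest r ρ)} => ((ρ : Str).length : ℕ∞)) ⟨ρ, hmem⟩
  calc KC U σ ≤ _ := hc σ
    _ ≤ ((l + 1 : ℕ) : ℕ∞) + c := by gcongr
    _ = (l : ℕ∞) + ((c + 1 : ℕ) : ℕ∞) := by push_cast; ring

/-- Kraft–Chaitin with arbitrary bounded weight. -/
theorem kc_lemma {U : Str →. Str} (hU : OptimalPF U) {r : ℕ → Option (ℕ × Str)} (hr : Computable r)
    (C : ℕ) (hs : ∀ n, ∑ k ∈ Finset.range n, rw2 (r k) ≤ C) :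
    ∃ c : ℕ, ∀ k l σ, r k = Option.some (l, σ) → KC U σ ≤ (l : ℕ∞) + c := by
  have hr' : Computable (fun k => (r k).map fun q => (q.1 + C, q.2)) := by
    refine Computable.option_map hr ?_
    exact Primrec.to_comp (Primrec.pair (Primrec.nat_add.comp (Primrec.fst.comp Primrec.snd)
      (Primrec.const C)) (Primrec.snd.comp Primrec.snd))
  obtain ⟨c, hc⟩ := kc_one hU hr' (by
    intro n
    have : ∀ k, rw2 ((r k).map fun q => (q.1 + C, q.2)) = rw2 (r k) * w2 C := by
      intro k
      rcases r k with _ | q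
      · simp [rw2]
      · simp [rw2, w2_add]
    rw [Finset.sum_congr rfl fun k _ => this k, ← Finset.sum_mul]
    have h1 := w2_mul_pow C
    have h2 := w2_pos C
    have h3 : (C : ℝ) ≤ 2 ^ C := by exact_mod_cast Nat.lt_two_pow_self.le
    calc _ ≤ (2 ^ C : ℝ) * w2 C := by gcongr; exact (hs n).trans h3
      _ = 1 := by rw [mul_comm]; exact h1)
  refine ⟨C + c, fun k l σ hk => ?_⟩
  have := hc k (l + C) σ (by rw [hk]; rfl)
  calc _ ≤ _ := this
    _ = _ := by push_cast; ring


/-! ### Part 2: Kraft inequality and an enumeration of programs -/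

theorem pf_ud {S : Set Str} (h0 : [] ∉ S)
    (hp : ∀ ρ₁ ρ₂ : Str, ρ₁ ∈ S → ρ₂ ∈ S → ρ₁ <+: ρ₂ → ρ₁ = ρ₂) :
    InformationTheory.UniquelyDecodable S := by
  intro L₁
  induction L₁ with
  | nil =>
    intro L₂ _ h2 he
    cases L₂ with
    | nil => rfl
    | cons w L =>
      simp only [List.flatten_nil, List.flatten_cons] at he
      have hw : w = [] := (List.append_eq_nil_iff.1 he.symm).1
      exact absurd (hw ▸ h2 w (by simp)) h0
  | cons w L ih =>
    intro L₂ h1 h2 he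
    cases L₂ with
    | nil =>
      simp only [List.flatten_nil, List.flatten_cons] at he
      have hw : w = [] := (List.append_eq_nil_iff.1 he).1
      exact absurd (hw ▸ h1 w (by simp)) h0
    | cons w' L' =>
      simp only [List.flatten_cons] at he
      have hw : w = w' := by
        rcases le_total w.length w'.length with hl | hl
        · exact hp w w' (h1 w (by simp)) (h2 w' (by simp))
            (List.prefix_of_prefix_length_le (he ▸ List.prefix_append w L.flatten)
              (List.prefix_append _ _) hl)
        · exact (hp w' w (h2 w' (by simp)) (h1 w (by simp))
            (List.prefix_of_prefix_length_le (he.symm ▸ List.prefix_append w' L'.flatten)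
              (List.prefix_append _ _) hl)).symm
      subst hw
      rw [List.append_cancel_left_eq] at he
      rw [ih L' (fun w hw => h1 w (by simp [hw])) (fun w hw => h2 w (by simp [hw])) he]

theorem kraft_pf {S : Finset Str}
    (hp : ∀ ρ₁ ρ₂ : Str, ρ₁ ∈ S → ρ₂ ∈ S → ρ₁ <+: ρ₂ → ρ₁ = ρ₂) :
    ∑ ρ ∈ S, w2 ρ.length ≤ 1 := by
  by_cases h0 : [] ∈ S
  · have : S = {[]} := by
      ext ρ
      simp only [Finset.mem_singleton]
      constructor
      · intro h; exact (hp [] ρ h0 h List.nil_prefix).symm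
      · rintro rfl; exact h0
    rw [this]; simp [w2]
  · have := InformationTheory.kraft_mcmillan_inequality (S := S)
      (pf_ud (by simpa using h0) (by simpa using hp))
    simpa [w2] using this

theorem geom_w2 (n : ℕ) : ∑ k ∈ Finset.range n, w2 (k + 1) ≤ 1 := by
  have : ∑ k ∈ Finset.range n, w2 (k + 1) = 1 - w2 n := by
    induction n with
    | zero => simp [w2]
    | succ n ih => rw [Finset.sum_range_succ, ih, ← w2_succ n]; ring
  rw [this]; linarith [w2_nonneg n]

theorem KC_ne_top {U : Str →. Str} (hU : OptimalPF U) (σ : Str) : KC U σ ≠ ⊤ := by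
  obtain ⟨c, hc⟩ := kc_lemma hU (r := fun k => Option.some (k + 1, (Encodable.decode k : Option Str).getD []))
    (Primrec.to_comp (Primrec.option_some.comp (Primrec.pair Primrec.succ
      (Primrec.option_getD.comp Primrec.decode (Primrec.const []))))) 1 (by
        intro n; simpa [rw2] using geom_w2 n)
  have := hc (Encodable.encode σ) (Encodable.encode σ + 1) σ (by simp)
  exact ne_top_of_le_ne_top (by simp) this

theorem KC_exists {U : Str →. Str} (hU : OptimalPF U) (σ : Str) :
    ∃ ρ : Str, σ ∈ U ρ ∧ KC U σ = (ρ.length : ℕ∞) := by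
  have hne : Nonempty {ρ : Str // σ ∈ U ρ} := by
    by_contra h
    rw [not_nonempty_iff] at h
    exact KC_ne_top hU σ (by unfold KC; exact iInf_of_empty _)
  obtain ⟨ρ, hρ⟩ := ciInf_mem (fun ρ : {ρ : Str // σ ∈ U ρ} => ((ρ : Str).length : ℕ∞))
  exact ⟨ρ, ρ.2, hρ.symm⟩

open Nat.Partrec (Code)

/-- bounded test -/
def tst (c : Code) (t q : ℕ) : Option ℕ :=
  (c.evaln t q).bind fun v => if v ≤ t then Option.some v else Option.none

theorem tst_some {c : Code} {t q v : ℕ} :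
    tst c t q = Option.some v ↔ c.evaln t q = Option.some v ∧ v ≤ t := by
  unfold tst
  rw [Option.bind_eq_some_iff]
  constructor
  · rintro ⟨a, h1, h2⟩
    split_ifs at h2 with h
    simp at h2; subst h2; exact ⟨h1, h⟩
  · rintro ⟨h1, h2⟩; exact ⟨v, h1, by simp [h2]⟩

theorem tst_mono {c : Code} {t t' q v : ℕ} (h : t ≤ t') (h1 : tst c t q = Option.some v) :
    tst c t' q = Option.some v := by
  rw [tst_some] at *
  exact ⟨Code.evaln_mono h h1.1, h1.2.trans h⟩

theorem tst_primrec (c : Code) : Primrec₂ (tst c) := by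
  unfold tst
  refine Primrec.option_bind (f := fun p : ℕ × ℕ => c.evaln p.1 p.2)
    (g := fun p v => if v ≤ p.1 then Option.some v else Option.none) ?_ ?_
  · exact Code.primrec_evaln.comp (Primrec.pair (Primrec.pair Primrec.fst (Primrec.const c)) Primrec.snd)
  · exact Primrec.ite (Primrec.nat_le.comp Primrec.snd (Primrec.fst.comp Primrec.fst))
      (Primrec.option_some.comp Primrec.snd) (Primrec.const _)

/-- genuine index: first stage at which the program halts -/
def genu (c : Code) (k : ℕ) : Prop :=
  (tst c k.unpair.1 k.unpair.2).isSome = true ∧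
    Encodable.encode ((Encodable.decode k.unpair.2 : Option Str).getD []) = k.unpair.2 ∧
    (k.unpair.1 = 0 ∨ (tst c (k.unpair.1 - 1) k.unpair.2).isSome = false)

theorem genu_primrec (c : Code) : PrimrecPred (genu c) := by
  have h1 : Primrec (fun k : ℕ => k.unpair.1) := Primrec.fst.comp Primrec.unpair
  have h2 : Primrec (fun k : ℕ => k.unpair.2) := Primrec.snd.comp Primrec.unpair
  refine PrimrecPred.and ?_ (PrimrecPred.and ?_ (PrimrecPred.or ?_ ?_))
  · exact Primrec.eq.comp (Primrec.option_isSome.comp ((tst_primrec c).comp h1 h2)) (Primrec.const true)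
  · exact Primrec.eq.comp (Primrec.encode.comp (Primrec.option_getD.comp (Primrec.decode.comp h2)
      (Primrec.const []))) h2
  · exact Primrec.eq.comp h1 (Primrec.const 0)
  · exact Primrec.eq.comp (Primrec.option_isSome.comp ((tst_primrec c).comp (Primrec.pred.comp h1) h2))
      (Primrec.const false)

/-- length of the `k`th program -/
noncomputable def enLen (c : Code) (k : ℕ) : ℕ :=
  if genu c k then ((Encodable.decode k.unpair.2 : Option Str).getD []).length else k + 1

/-- output of the `k`th program -/
noncomputable def enOut (c : Code) (k : ℕ) : Str :=
  if genu c k then (Encodable.decode ((tst c k.unpair.1 k.unpair.2).getD 0) : Option Str).getD [] else []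

theorem enLen_primrec (c : Code) : Primrec (enLen c) := by
  have h2 : Primrec (fun k : ℕ => k.unpair.2) := Primrec.snd.comp Primrec.unpair
  exact Primrec.ite (genu_primrec c) (Primrec.list_length.comp (Primrec.option_getD.comp
    (Primrec.decode.comp h2) (Primrec.const []))) Primrec.succ

theorem enOut_primrec (c : Code) : Primrec (enOut c) := by
  have h1 : Primrec (fun k : ℕ => k.unpair.1) := Primrec.fst.comp Primrec.unpair
  have h2 : Primrec (fun k : ℕ => k.unpair.2) := Primrec.snd.comp Primrec.unpair
  exact Primrec.ite (genu_primrec c) (Primrec.option_getD.comp (Primrec.decode.comp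
    (Primrec.option_getD.comp ((tst_primrec c).comp h1 h2) (Primrec.const 0))) (Primrec.const []))
    (Primrec.const [])


/-- `c` computes `U` on codes. -/
def CodeOf (U : Str →. Str) (c : Code) : Prop :=
  ∀ ρ : Str, c.eval (Encodable.encode ρ) = (U ρ).map Encodable.encode

theorem exists_codeOf {U : Str →. Str} (h : Partrec U) : ∃ c, CodeOf U c := by
  obtain ⟨c, hc⟩ := Code.exists_code.1 h
  refine ⟨c, fun ρ => ?_⟩
  rw [hc]
  simp [Encodable.encodek]

theorem genu_spec {U : Str →. Str} {c : Code} (hc : CodeOf U c) {k : ℕ} (h : genu c k) :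
    ∃ ρ : Str, Encodable.encode ρ = k.unpair.2 ∧ enLen c k = ρ.length ∧ enOut c k ∈ U ρ ∧
      (enOut c k).length ≤ k.unpair.1 := by
  refine ⟨(Encodable.decode k.unpair.2 : Option Str).getD [], h.2.1, by rw [enLen, if_pos h], ?_⟩
  obtain ⟨v, hv⟩ := Option.isSome_iff_exists.1 h.1
  have hv' := tst_some.1 hv
  have h3 := Code.evaln_sound (Option.mem_def.2 hv'.1)
  rw [← h.2.1, hc] at h3
  rw [Part.mem_map_iff] at h3
  obtain ⟨σ, h4, h5⟩ := h3
  have : enOut c k = σ := by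
    rw [enOut, if_pos h, hv, ← h5]; simp
  rw [this]
  refine ⟨h4, ?_⟩
  have h1 : σ.length ≤ Encodable.encode σ := Encodable.length_le_encode σ
  omega

theorem genu_inj {c : Code} {k k' : ℕ} (h : genu c k) (h' : genu c k')
    (e : k.unpair.2 = k'.unpair.2) : k = k' := by
  have key : ∀ {k k' : ℕ}, genu c k → genu c k' → k.unpair.2 = k'.unpair.2 →
      ¬ k.unpair.1 < k'.unpair.1 := by
    intro k k' h h' e hlt
    rcases h'.2.2 with h0 | h0
    · omega
    · obtain ⟨v, hv⟩ := Option.isSome_iff_exists.1 h.1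
      rw [e] at hv
      rw [tst_mono (by omega) hv] at h0
      simp at h0
  have e1 : k.unpair.1 = k'.unpair.1 := by
    have := key h h' e
    have := key h' h e.symm
    omega
  rw [← Nat.pair_unpair k, ← Nat.pair_unpair k', e, e1]

theorem exists_enum {U : Str →. Str} (hU : OptimalPF U) :
    ∃ (len : ℕ → ℕ) (out : ℕ → Str), Primrec len ∧ Primrec out ∧ (∀ k, (out k).length ≤ k) ∧
      (∀ k, len k ≤ k + 1) ∧ (∀ S : Finset ℕ, ∑ k ∈ S, w2 (len k) ≤ 2) ∧
      (∃ c0 : ℕ, ∀ k, KC U (out k) ≤ (len k : ℕ∞) + c0) ∧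
      ∀ σ, ∃ k, out k = σ ∧ KC U σ = (len k : ℕ∞) := by
  obtain ⟨c, hc⟩ := exists_codeOf hU.1.1
  refine ⟨enLen c, enOut c, enLen_primrec c, enOut_primrec c, ?_, ?_, ?_, ?_, ?_⟩
  · intro k
    by_cases h : genu c k
    · obtain ⟨ρ, _, _, _, h4⟩ := genu_spec hc h
      exact h4.trans (Nat.unpair_left_le k)
    · rw [enOut, if_neg h]; simp
  · intro k
    by_cases h : genu c k
    · obtain ⟨ρ, h1, h2, _, h4⟩ := genu_spec hc h
      have h1' : ρ.length ≤ Encodable.encode ρ := Encodable.length_le_encode ρ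
      have := Nat.unpair_right_le k
      omega
    · rw [enLen, if_neg h]
  · intro S
    have hsub : S ⊆ Finset.range (S.sup id + 1) := by
      intro x hx
      simp only [Finset.mem_range]
      exact Nat.lt_succ_of_le (Finset.le_sup (f := id) hx)
    refine (Finset.sum_le_sum_of_subset_of_nonneg hsub fun _ _ _ => w2_nonneg _).trans ?_
    generalize S.sup id + 1 = n
    rw [← Finset.sum_filter_add_sum_filter_not (Finset.range n) (genu c)]
    have h1 : ∑ k ∈ Finset.range n with genu c k, w2 (enLen c k) ≤ 1 := by
      set f : ℕ → Str := fun k => (Encodable.decode k.unpair.2 : Option Str).getD []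
      have hinj : Set.InjOn f (Finset.filter (genu c) (Finset.range n) : Set ℕ) := by
        intro k hk k' hk' e
        simp only [Finset.coe_filter, Set.mem_ofPred_eq] at hk hk'
        refine genu_inj hk.2 hk'.2 ?_
        rw [← hk.2.2.1, ← hk'.2.2.1]
        exact congrArg Encodable.encode e
      have : ∑ k ∈ Finset.range n with genu c k, w2 (enLen c k)
          = ∑ ρ ∈ (Finset.filter (genu c) (Finset.range n)).image f, w2 ρ.length := by
        rw [Finset.sum_image hinj]
        refine Finset.sum_congr rfl fun k hk => ?_
        simp only [Finset.mem_filter] at hk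
        rw [enLen, if_pos hk.2]
      rw [this]
      have hd : ∀ ρ ∈ (Finset.filter (genu c) (Finset.range n)).image f, (U ρ).Dom := by
        intro ρ hρ
        rw [Finset.mem_image] at hρ
        obtain ⟨k, hk, rfl⟩ := hρ
        simp only [Finset.mem_filter] at hk
        obtain ⟨ρ, h1, h2, h3, h4⟩ := genu_spec hc hk.2
        have : f k = ρ := by
          show (Encodable.decode k.unpair.2 : Option Str).getD [] = ρ
          rw [← h1]; simp
        rw [this]
        exact Part.dom_iff_mem.2 ⟨_, h3⟩
      exact kraft_pf fun ρ₁ ρ₂ h1 h2 => hU.1.2 ρ₁ ρ₂ (hd _ h1) (hd _ h2)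
    have h2 : ∑ k ∈ Finset.range n with ¬ genu c k, w2 (enLen c k) ≤ 1 := by
      calc _ = ∑ k ∈ Finset.range n with ¬ genu c k, w2 (k + 1) := by
            refine Finset.sum_congr rfl fun k hk => ?_
            simp only [Finset.mem_filter] at hk
            rw [enLen, if_neg hk.2]
        _ ≤ ∑ k ∈ Finset.range n, w2 (k + 1) :=
            Finset.sum_le_sum_of_subset_of_nonneg (Finset.filter_subset _ _) fun _ _ _ => w2_nonneg _
        _ ≤ 1 := geom_w2 n
    linarith
  · obtain ⟨m, hm⟩ := ENat.ne_top_iff_exists.1 (KC_ne_top hU [])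
    refine ⟨m, fun k => ?_⟩
    by_cases h : genu c k
    · obtain ⟨ρ, h1, h2, h3, _⟩ := genu_spec hc h
      rw [h2]
      refine le_trans ?_ le_self_add
      exact iInf_le (fun ρ : {ρ : Str // enOut c k ∈ U ρ} => ((ρ : Str).length : ℕ∞)) ⟨ρ, h3⟩
    · rw [enOut, if_neg h, ← hm]
      exact le_add_self
  · intro σ
    obtain ⟨ρ, h1, h2⟩ := KC_exists hU σ
    have h3 : Encodable.encode σ ∈ c.eval (Encodable.encode ρ) := by
      rw [hc]; exact Part.mem_map _ h1
    obtain ⟨t, ht⟩ := Code.evaln_complete.1 h3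
    have hex : ∃ t, (tst c t (Encodable.encode ρ)).isSome = true := by
      refine ⟨max t (Encodable.encode σ), ?_⟩
      rw [Option.isSome_iff_exists]
      exact ⟨Encodable.encode σ, tst_some.2 ⟨Code.evaln_mono (le_max_left _ _) ht, le_max_right _ _⟩⟩
    set t0 := Nat.find hex with ht0
    have hg : genu c (Nat.pair t0 (Encodable.encode ρ)) := by
      refine ⟨by simpa using Nat.find_spec hex, by simp, ?_⟩
      rcases Nat.eq_zero_or_pos t0 with h | h
      · left; simpa using h
      · right
        have := Nat.find_min hex (m := t0 - 1) (by omega)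
        simpa using this
    refine ⟨Nat.pair t0 (Encodable.encode ρ), ?_, ?_⟩
    · obtain ⟨ρ', e1, e2, e3, e4⟩ := genu_spec hc hg
      simp only [Nat.unpair_pair] at e1
      have := Encodable.encode_injective e1
      subst this
      exact Part.mem_unique e3 h1
    · obtain ⟨ρ', e1, e2, e3, e4⟩ := genu_spec hc hg
      simp only [Nat.unpair_pair] at e1
      have := Encodable.encode_injective e1
      subst this
      rw [e2, h2]


/-! ### Part 3: Turing degree of the constructed set -/

open Nat.Partrec (Code)

theorem RecursiveIn.of_partrec {O f : ℕ →. ℕ} (h : Nat.Partrec f) : RecursiveIn O f := by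
  induction h with
  | zero => exact RecursiveIn.zero
  | succ => exact RecursiveIn.succ
  | left => exact RecursiveIn.left
  | right => exact RecursiveIn.right
  | pair _ _ h1 h2 => exact RecursiveIn.pair h1 h2
  | comp _ _ h1 h2 => exact RecursiveIn.comp h1 h2
  | prec _ _ h1 h2 => exact RecursiveIn.prec h1 h2
  | rfind _ h => exact RecursiveIn.rfind h

theorem RecursiveIn.of_primrec {O : ℕ →. ℕ} {f : ℕ → ℕ} (h : Primrec f) :
    RecursiveIn O (f : ℕ →. ℕ) :=
  RecursiveIn.of_partrec (Partrec.nat_iff.1 h.to_comp)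

theorem RecursiveIn.of_eq {O f g : ℕ →. ℕ} (h : RecursiveIn O f) (e : ∀ n, f n = g n) :
    RecursiveIn O g := by
  have : f = g := funext e
  rw [← this]; exact h

theorem pbind (a : ℕ) (f : ℕ →. ℕ) : (Part.some a >>= f) = f a := Part.bind_some a f

/-- halting by stage `s` -/
def hal (i s : ℕ) : Bool := (Code.evaln s (Denumerable.ofNat Code i) i).isSome

theorem hal_primrec : Primrec₂ hal := by
  refine Primrec.option_isSome.comp (Code.primrec_evaln.comp (Primrec.pair (Primrec.pair Primrec.snd
    ((Primrec.ofNat Code).comp Primrec.fst)) Primrec.fst))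

theorem hal_mono {i s t : ℕ} (h : s ≤ t) (h1 : hal i s = true) : hal i t = true := by
  unfold hal at *
  rw [Option.isSome_iff_exists] at *
  obtain ⟨v, hv⟩ := h1
  exact ⟨v, Code.evaln_mono h hv⟩

theorem mem_halting_iff (i : ℕ) : i ∈ haltingSet ↔ ∃ s, hal i s = true := by
  change ((Denumerable.ofNat Code i).eval i).Dom ↔ _
  rw [Part.dom_iff_mem]
  constructor
  · rintro ⟨y, hy⟩
    obtain ⟨k, hk⟩ := Code.evaln_complete.1 hy
    exact ⟨k, by unfold hal; rw [Option.isSome_iff_exists]; exact ⟨y, hk⟩⟩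
  · rintro ⟨s, hs⟩
    unfold hal at hs; rw [Option.isSome_iff_exists] at hs
    obtain ⟨y, hy⟩ := hs
    exact ⟨y, Code.evaln_sound hy⟩

theorem ce_le_halting {B : Set ℕ} (hB : CESet B) : TuringLeSet B haltingSet := by
  obtain ⟨f, hf, hd⟩ := hB
  obtain ⟨c, rfl⟩ := Code.exists_code.1 hf
  set g : ℕ → ℕ := fun x => Encodable.encode (Code.comp c (Code.const x)) with hg
  have hgp : Primrec g :=
    Primrec.encode.comp (Code.primrec₂_comp.comp (Primrec.const c) Code.primrec_const)
  have hgs : ∀ x, x ∈ B ↔ g x ∈ haltingSet := by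
    intro x
    rw [hd]
    change _ ↔ ((Denumerable.ofNat Code (g x)).eval (g x)).Dom
    rw [hg]
    simp only [Denumerable.ofNat_encode, Code.eval, Code.eval_const, pbind]
  unfold TuringLeSet
  have := RecursiveIn.comp (RecursiveIn.oracle (O := chi haltingSet)) (RecursiveIn.of_primrec hgp)
  refine this.of_eq fun x => ?_
  simp only [PFun.coe_val, pbind]
  simp only [chi]
  rw [hgs]

/-- The set of removed markers. -/
def Bset (idx : ℕ → ℕ) : Set ℕ := {u | ∃ v, u < v ∧ idx v ≤ idx u}

theorem Bset_ce {idx : ℕ → ℕ} (h : Primrec idx) : CESet (Bset idx) := by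
  have hc : Computable₂ (fun u v : ℕ => (decide (u < v ∧ idx v ≤ idx u) : Bool)) := by
    refine Primrec.to_comp ?_
    exact PrimrecPred.decide (p := fun x : ℕ × ℕ => x.1 < x.2 ∧ idx x.2 ≤ idx x.1)
      (PrimrecPred.and (Primrec.nat_lt.comp Primrec.fst Primrec.snd)
      (Primrec.nat_le.comp (h.comp Primrec.snd) (h.comp Primrec.fst)))
  refine ⟨fun u => Nat.rfind fun v => Part.some (decide (u < v ∧ idx v ≤ idx u)), ?_, ?_⟩
  · exact Partrec.nat_iff.1 (Partrec.rfind hc.partrec₂)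
  · intro u
    refine Iff.trans ?_ (Nat.rfind_dom (p := fun v => Part.some (decide (u < v ∧ idx v ≤ idx u)))).symm
    constructor
    · rintro ⟨v, hv⟩
      exact ⟨v, by simp [hv.1, hv.2], fun {m} _ => trivial⟩
    · rintro ⟨v, hv, _⟩
      simp at hv
      exact ⟨v, hv⟩

theorem halting_le_Bset {idx : ℕ → ℕ} (h : Primrec idx)
    (hH : ∀ u, u ∉ Bset idx → idx u ∈ haltingSet → hal (idx u) u = true)
    (hfin : ∀ i, ∃ u, u ∉ Bset idx ∧ idx u = i) : TuringLeSet haltingSet (Bset idx) := by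
  unfold TuringLeSet
  set O := chi (Bset idx)
  -- test function
  set g : ℕ → ℕ := fun x => if idx x.unpair.1.unpair.2 = x.unpair.1.unpair.1 ∧ x.unpair.2 = 0 then 0 else 1
  have hu1 : Primrec (fun k : ℕ => k.unpair.1) := Primrec.fst.comp Primrec.unpair
  have hu2 : Primrec (fun k : ℕ => k.unpair.2) := Primrec.snd.comp Primrec.unpair
  have hg : Primrec g := by
    refine Primrec.ite (PrimrecPred.and (Primrec.eq.comp (h.comp (hu2.comp hu1)) (hu1.comp hu1))
      (Primrec.eq.comp hu2 (Primrec.const 0))) (Primrec.const 0) (Primrec.const 1)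
  have h1 : RecursiveIn O (fun x => O x.unpair.2) := by
    have := RecursiveIn.comp (RecursiveIn.oracle (O := O)) (RecursiveIn.right (O := O))
    refine this.of_eq fun x => ?_
    simp only [PFun.coe_val, pbind]
  have h2 := RecursiveIn.comp (RecursiveIn.of_primrec hg)
    (RecursiveIn.pair (RecursiveIn.of_primrec (O := O) Primrec.id) h1)
  have h3 := RecursiveIn.rfind h2
  set k : ℕ → ℕ := fun x => cond (hal x.unpair.1 x.unpair.2) 1 0
  have hk : Primrec k := Primrec.cond (hal_primrec.comp hu1 hu2) (Primrec.const 1) (Primrec.const 0)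
  have h4 := RecursiveIn.comp (RecursiveIn.of_primrec hk)
    (RecursiveIn.pair (RecursiveIn.of_primrec (O := O) Primrec.id) h3)
  refine h4.of_eq fun i => ?_
  obtain ⟨u, hu, hui⟩ := hfin i
  have hval : ∀ n, (fun m : ℕ => decide (m = 0)) <$> ((Nat.pair <$> (↑(id : ℕ → ℕ) : ℕ →. ℕ) (Nat.pair i n) <*>
      O (Nat.pair i n).unpair.2) >>= (g : ℕ →. ℕ)) = Part.some (decide (idx n = i ∧ n ∉ Bset idx)) := by
    intro n
    have e : O (Nat.pair i n).unpair.2 = Part.some (if n ∈ Bset idx then 1 else 0) := by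
      simp [O, chi]
    rw [e]
    have e2 : (Nat.pair <$> (↑(id : ℕ → ℕ) : ℕ →. ℕ) (Nat.pair i n) <*>
      (Part.some (if n ∈ Bset idx then 1 else 0) : Part ℕ)) = Part.some (Nat.pair (Nat.pair i n) (if n ∈ Bset idx then 1 else 0)) := by
      simp [Seq.seq]
    rw [e2]
    simp only [pbind, PFun.coe_val, Part.map_eq_map, Part.map_some, g]
    congr 1
    by_cases hb : n ∈ Bset idx <;> by_cases hi : idx n = i <;> simp [hb, hi]
  have hr : ∃ n, n ∈ (Nat.rfind fun n => (fun m : ℕ => decide (m = 0)) <$> ((Nat.pair <$> (↑(id : ℕ → ℕ) : ℕ →. ℕ) (Nat.pair i n) <*>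
      O (Nat.pair i n).unpair.2) >>= (g : ℕ →. ℕ))) := by
    rw [← Part.dom_iff_mem]
    apply Nat.rfind_dom.2
    refine ⟨u, ?_, ?_⟩
    · rw [hval]; simp [hu, hui]
    · intro m _; rw [hval]; trivial
  obtain ⟨n, hn⟩ := hr
  have hn' := (hval n) ▸ Nat.rfind_spec hn
  simp at hn'
  have := Part.eq_some_iff.2 hn
  rw [this]
  simp only [chi, Seq.seq, PFun.coe_val, id, Part.map_eq_map, Part.map_some, Part.bind_some, pbind, k]
  congr 1
  simp only [Nat.unpair_pair]
  by_cases hh : i ∈ haltingSet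
  · have := hH n hn'.2 (by rw [hn'.1]; exact hh)
    rw [hn'.1] at this
    simp [hh, this]
  · have : hal i n = false := by
      by_contra hc
      exact hh ((mem_halting_iff i).2 ⟨n, by simpa using hc⟩)
    simp [hh, this]


/-! ### Part 4: primitive recursive toolbox -/

section prim
variable {α : Type*} [Primcodable α]

theorem pr_forall {b : α → ℕ} {R : α → ℕ → Prop} (hb : Primrec b)
    (hR : PrimrecPred fun x : α × ℕ => R x.1 x.2) : PrimrecPred fun a => ∀ v < b a, R a v := by
  have h1 : PrimrecRel (fun (v : ℕ) (a : α) => R a v) :=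
    PrimrecPred.comp hR (Primrec.pair Primrec.snd Primrec.fst)
  exact ((PrimrecRel.forall_mem_list h1).comp (Primrec.list_range.comp hb) Primrec.id).of_eq (by simp)

theorem pr_exists {b : α → ℕ} {R : α → ℕ → Prop} (hb : Primrec b)
    (hR : PrimrecPred fun x : α × ℕ => R x.1 x.2) : PrimrecPred fun a => ∃ v < b a, R a v := by
  have h1 : PrimrecRel (fun (v : ℕ) (a : α) => R a v) :=
    PrimrecPred.comp hR (Primrec.pair Primrec.snd Primrec.fst)
  exact ((PrimrecRel.exists_mem_list h1).comp (Primrec.list_range.comp hb) Primrec.id).of_eq (by simp)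

theorem pr_sum {b : α → ℕ} {f : α → ℕ → ℕ} (hb : Primrec b)
    (hf : Primrec fun x : α × ℕ => f x.1 x.2) :
    Primrec fun a => ∑ v ∈ Finset.range (b a), f a v := by
  have : Primrec (fun a => Nat.rec (motive := fun _ => ℕ) 0 (fun v s => s + f a v) (b a)) := by
    refine Primrec.nat_rec' (h := fun a (x : ℕ × ℕ) => x.2 + f a x.1) hb (Primrec.const 0) ?_
    exact Primrec.nat_add.comp (Primrec.snd.comp Primrec.snd)
      (hf.comp (Primrec.pair Primrec.fst (Primrec.fst.comp Primrec.snd)))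
  refine this.of_eq fun a => ?_
  induction b a with
  | zero => rfl
  | succ n ih => rw [Finset.sum_range_succ, ← ih]

theorem pr_imp {p q : α → Prop} (hp : PrimrecPred p) (hq : PrimrecPred q) :
    PrimrecPred fun a => p a → q a :=
  (hp.not.or hq).of_eq fun a => by tauto

end prim

/-- bounded search: least `i < b` with `Q i`, else `b` -/
noncomputable def lst (Q : ℕ → Prop) : ℕ → ℕ
  | 0 => 0
  | b + 1 => if lst Q b < b then lst Q b else if Q b then b else b + 1

theorem lst_le (Q : ℕ → Prop) (b : ℕ) : lst Q b ≤ b := by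
  induction b with
  | zero => exact le_rfl
  | succ b ih => simp only [lst]; split_ifs <;> omega

theorem lst_min {Q : ℕ → Prop} {b j : ℕ} (h : j < lst Q b) : ¬ Q j := by
  induction b with
  | zero => simp [lst] at h
  | succ b ih =>
    simp only [lst] at h
    have := lst_le Q b
    split_ifs at h with h1 h2
    · exact ih h
    · exact ih (by omega)
    · rcases Nat.lt_or_ge j b with h3 | h3
      · exact ih (by omega)
      · have : j = b := by omega
        subst this; exact h2

theorem lst_spec {Q : ℕ → Prop} {b : ℕ} (h : lst Q b < b) : Q (lst Q b) := by
  induction b with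
  | zero => omega
  | succ b ih =>
    simp only [lst] at h ⊢
    split_ifs at h ⊢ with h1 h2
    · exact ih h1
    · exact h2
    · omega

theorem lst_lt {Q : ℕ → Prop} {b i : ℕ} (hi : i < b) (hQ : Q i) : lst Q b < b := by
  by_contra h
  exact lst_min (Q := Q) (b := b) (j := i) (by omega) hQ

theorem lst_congr {Q Q' : ℕ → Prop} {b : ℕ} (h : ∀ i < b, (Q i ↔ Q' i)) : lst Q b = lst Q' b := by
  induction b with
  | zero => rfl
  | succ b ih =>
    simp only [lst]
    rw [ih fun i hi => h i (by omega)]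
    simp only [h b (by omega)]

theorem pr_lst {α : Type*} [Primcodable α] {b : α → ℕ} {Q : α → ℕ → Prop} (hb : Primrec b)
    (hQ : PrimrecPred fun x : α × ℕ => Q x.1 x.2) : Primrec fun a => lst (Q a) (b a) := by
  have : Primrec (fun a => Nat.rec (motive := fun _ => ℕ) 0 
      (fun v s => if s < v then s else if Q a v then v else v + 1) (b a)) := by
    refine Primrec.nat_rec' (h := fun a (x : ℕ × ℕ) => if x.2 < x.1 then x.2 else if Q a x.1 then x.1
      else x.1 + 1) hb (Primrec.const 0) ?_
    have hv : Primrec fun x : α × (ℕ × ℕ) => x.2.1 := Primrec.fst.comp Primrec.snd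
    have hs : Primrec fun x : α × (ℕ × ℕ) => x.2.2 := Primrec.snd.comp Primrec.snd
    exact Primrec.ite (Primrec.nat_lt.comp hs hv) hs
      (Primrec.ite (hQ.comp (Primrec.pair Primrec.fst hv)) hv (Primrec.succ.comp hv))
  refine this.of_eq fun a => ?_
  induction b a with
  | zero => rfl
  | succ n ih => simp only [lst]; rw [ih]

/-! ### The construction -/

/-- parameters of the construction -/
structure Par where
  len : ℕ → ℕ
  out : ℕ → Str
  e : Bool → ℕ → ℕ → Bool
  lenP : Primrec len
  outP : Primrec out
  eP : Primrec fun x : Bool × (ℕ × ℕ) => e x.1 x.2.1 x.2.2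
  hout : ∀ k, (out k).length ≤ k
  hlen : ∀ k, len k ≤ k + 1
  hsum : ∀ S : Finset ℕ, ∑ k ∈ S, w2 (len k) ≤ 2
  emono : ∀ z s t x, s ≤ t → e z s x = true → e z t x = true

/-- stage record: index, identifier, flag, processed program -/
abbrev Rc := ℕ × ℕ × ℕ × ℕ

def zOf (s : ℕ) : Bool := s.bodd
def kOf (s : ℕ) : ℕ := s.div2.unpair.1

/-- numerical code of `z` in flags -/
def zc (z : Bool) : ℕ := cond z 2 1

def alive (H : ℕ → Rc) (u s : ℕ) : Prop := u < s ∧ ∀ v < s, u < v → (H u).1 < (H v).1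

namespace Par
variable (P : Par)

def restr (z : Bool) (s n : ℕ) : Str := (List.range n).map (P.e z s)

def cur (z : Bool) (k s : ℕ) : Prop := P.out k = P.restr z s (P.out k).length

def new (s : ℕ) : Prop :=
  P.cur (zOf s) (kOf s) s ∧ ∀ a < s, zOf a = zOf s → kOf a = kOf s → ¬ P.cur (zOf s) (kOf s) a

def processed (H : ℕ → Rc) (z : Bool) (p k s : ℕ) : Prop :=
  ∃ s' < s + 1, (H s').2.2.1 = zc z ∧ (H s').2.1 = p ∧ (H s').2.2.2 = k ∧
    P.restr z s' (P.out k).length = P.restr z s (P.out k).length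

noncomputable def tt (H : ℕ → Rc) (z : Bool) (u : ℕ) : ℕ :=
  lst (fun k => ¬ P.processed H z (H u).2.1 k u) (u + 1)

def wset (H : ℕ → Rc) (z : Bool) (p t s a : ℕ) : Prop :=
  zOf a = z ∧ P.new a ∧ P.cur z (kOf a) s ∧
    ∃ u < a + 1, u < (P.out (kOf a)).length ∧ alive H u (a + 1) ∧ (H u).2.1 = p ∧ P.tt H z u = t

noncomputable def Wt (H : ℕ → Rc) (z : Bool) (p t s : ℕ) : ℝ :=
  ∑ a ∈ Finset.range s, if P.wset H z p t s a then w2 (P.len (kOf a)) else 0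

def wantT (H : ℕ → Rc) (u s : ℕ) : Prop :=
  P.new s ∧ u < (P.out (kOf s)).length ∧
    w2 (P.len (P.tt H (zOf s) u) + (H u).2.1) ≤
      P.Wt H (zOf s) (H u).2.1 (P.tt H (zOf s) u) s + w2 (P.len (kOf s))

def wantX (H : ℕ → Rc) (u s : ℕ) (z : Bool) : Prop :=
  ∀ n < u, ∃ k < s, P.out k = P.restr z s n ∧ ∀ j < s, P.out j = zeroStr n →
    P.len k ≤ P.len j + 2 * (H u).2.1

def wantH (H : ℕ → Rc) (u s : ℕ) : Prop := hal (H u).1 u = false ∧ hal (H u).1 s = true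

def want (H : ℕ → Rc) (u s : ℕ) : Prop :=
  alive H u s ∧ (wantH H u s ∨ (P.wantX H u s false ∨ P.wantX H u s true) ∨ P.wantT H u s)

noncomputable def chs (H : ℕ → Rc) (s : ℕ) : ℕ := lst (fun u => P.want H u s) s

noncomputable def step (s : ℕ) (H : ℕ → Rc) : Rc :=
  if P.chs H s < s then
    ((H (P.chs H s)).1, (H (P.chs H s)).2.1, 
      (if P.wantT H (P.chs H s) s then zc (zOf s) else 0), P.tt H (zOf s) (P.chs H s))
  else (if s = 0 then 0 else (H (s - 1)).1 + 1, s, 0, 0)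

noncomputable def F (s : ℕ) : Rc := P.step s fun n => if _h : n < s then F n else (0, 0, 0, 0)
termination_by s

end Par

/-! ### Part 5: the construction is primitive recursive -/

namespace Par
variable (P : Par)

theorem alive_congr {H H' : ℕ → Rc} {u s : ℕ} (h : ∀ n < s, H n = H' n) :
    alive H u s ↔ alive H' u s := by
  unfold alive
  refine and_congr_right fun hu => ?_
  rw [h u hu]
  exact forall₂_congr fun v hv => by rw [h v hv]

theorem processed_congr {H H' : ℕ → Rc} {z p k s} (h : ∀ n < s + 1, H n = H' n) :
    P.processed H z p k s ↔ P.processed H' z p k s := by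
  unfold processed
  refine exists_congr fun v => and_congr_right fun hv => ?_
  rw [h v hv]

theorem tt_congr {H H' : ℕ → Rc} {z u} (h : ∀ n < u + 1, H n = H' n) :
    P.tt H z u = P.tt H' z u := by
  unfold tt
  refine lst_congr fun i _ => ?_
  rw [h u (by omega), P.processed_congr h]

theorem wset_congr {H H' : ℕ → Rc} {z p t s a} (h : ∀ n < a + 1, H n = H' n) :
    P.wset H z p t s a ↔ P.wset H' z p t s a := by
  unfold wset
  refine and_congr_right fun _ => and_congr_right fun _ => and_congr_right fun _ => ?_
  refine exists_congr fun u => and_congr_right fun hu => ?_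
  rw [h u hu, alive_congr h, P.tt_congr (H := H) (H' := H') (fun n hn => h n (by omega))]

theorem Wt_congr {H H' : ℕ → Rc} {z p t s} (h : ∀ n < s, H n = H' n) :
    P.Wt H z p t s = P.Wt H' z p t s := by
  unfold Wt
  refine Finset.sum_congr rfl fun a ha => ?_
  rw [Finset.mem_range] at ha
  simp only [P.wset_congr (H := H) (H' := H') (a := a) (fun n hn => h n (by omega))]

theorem wantT_congr {H H' : ℕ → Rc} {u s} (hu : u < s) (h : ∀ n < s, H n = H' n) :
    P.wantT H u s ↔ P.wantT H' u s := by
  unfold wantT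
  rw [h u hu, P.tt_congr (H := H) (H' := H') (fun n hn => h n (by omega)), P.Wt_congr h]

theorem want_congr {H H' : ℕ → Rc} {u s} (hu : u < s) (h : ∀ n < s, H n = H' n) :
    P.want H u s ↔ P.want H' u s := by
  unfold want wantX wantH
  rw [P.wantT_congr hu h, h u hu, alive_congr h]

theorem chs_congr {H H' : ℕ → Rc} {s} (h : ∀ n < s, H n = H' n) :
    P.chs H s = P.chs H' s := lst_congr fun _ hi => P.want_congr hi h

theorem step_congr {H H' : ℕ → Rc} {s} (h : ∀ n < s, H n = H' n) :
    P.step s H = P.step s H' := by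
  unfold step
  rw [P.chs_congr h]
  split_ifs with h1 h2 h3 h4 h5
  · rw [h _ h1, P.tt_congr (H := H) (H' := H') (fun n hn => h n (by omega))]
  · exact absurd ((P.wantT_congr h1 h).1 h2) h3
  · exact absurd ((P.wantT_congr h1 h).2 h4) h2
  · rw [h _ h1, P.tt_congr (H := H) (H' := H') (fun n hn => h n (by omega))]
  · rfl
  · rw [h _ (by omega)]

theorem F_eq (s : ℕ) : P.F s = P.step s P.F := by
  rw [F]
  exact P.step_congr fun n hn => by simp [hn]

/-! primitive recursiveness -/

def gd (L : List Rc) (n : ℕ) : Rc := L.getD n (0, 0, 0, 0)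

section
variable {α : Type*} [Primcodable α]

theorem pr_gd {L : α → List Rc} {n : α → ℕ} (hL : Primrec L) (hn : Primrec n) :
    Primrec fun a => gd (L a) (n a) := (Primrec.list_getD _).comp hL hn

theorem pr_zOf : Primrec zOf := Primrec.nat_bodd
theorem pr_kOf : Primrec kOf :=
  Primrec.fst.comp (Primrec.unpair.comp Primrec.nat_div2)
theorem pr_zc {z : α → Bool} (hz : Primrec z) : Primrec fun a => zc (z a) :=
  Primrec.cond hz (Primrec.const 2) (Primrec.const 1)

theorem pr_len_out {k : α → ℕ} (hk : Primrec k) : Primrec fun a => (P.out (k a)).length :=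
  Primrec.list_length.comp (P.outP.comp hk)

theorem pr_restr {z : α → Bool} {s n : α → ℕ} (hz : Primrec z) (hs : Primrec s) (hn : Primrec n) :
    Primrec fun a => P.restr (z a) (s a) (n a) := by
  unfold restr
  refine Primrec.list_map (Primrec.list_range.comp hn) ?_
  exact P.eP.comp (Primrec.pair (hz.comp Primrec.fst)
    (Primrec.pair (hs.comp Primrec.fst) Primrec.snd))

theorem pr_cur {z : α → Bool} {k s : α → ℕ} (hz : Primrec z) (hk : Primrec k) (hs : Primrec s) :
    PrimrecPred fun a => P.cur (z a) (k a) (s a) :=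
  Primrec.eq.comp (P.outP.comp hk) (P.pr_restr hz hs (P.pr_len_out hk))

theorem pr_new {s : α → ℕ} (hs : Primrec s) : PrimrecPred fun a => P.new (s a) := by
  have h1 : Primrec fun x : α × ℕ => s x.1 := hs.comp Primrec.fst
  refine PrimrecPred.and (P.pr_cur (pr_zOf.comp hs) (pr_kOf.comp hs) hs) ?_
  refine pr_forall hs ?_
  refine pr_imp (Primrec.eq.comp (pr_zOf.comp Primrec.snd) (pr_zOf.comp h1)) ?_
  refine pr_imp (Primrec.eq.comp (pr_kOf.comp Primrec.snd) (pr_kOf.comp h1)) ?_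
  exact (P.pr_cur (pr_zOf.comp h1) (pr_kOf.comp h1) Primrec.snd).not

theorem pr_alive {L : α → List Rc} {u s : α → ℕ} (hL : Primrec L) (hu : Primrec u)
    (hs : Primrec s) : PrimrecPred fun a => alive (gd (L a)) (u a) (s a) := by
  have hL1 : Primrec fun x : α × ℕ => L x.1 := hL.comp Primrec.fst
  have hu1 : Primrec fun x : α × ℕ => u x.1 := hu.comp Primrec.fst
  refine PrimrecPred.and (Primrec.nat_lt.comp hu hs) (pr_forall hs ?_)
  refine pr_imp (Primrec.nat_lt.comp hu1 Primrec.snd) ?_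
  exact Primrec.nat_lt.comp (Primrec.fst.comp (pr_gd hL1 hu1))
    (Primrec.fst.comp (pr_gd hL1 Primrec.snd))

theorem pr_processed {L : α → List Rc} {z : α → Bool} {p k s : α → ℕ} (hL : Primrec L)
    (hz : Primrec z) (hp : Primrec p) (hk : Primrec k) (hs : Primrec s) :
    PrimrecPred fun a => P.processed (gd (L a)) (z a) (p a) (k a) (s a) := by
  have hL1 : Primrec fun x : α × ℕ => L x.1 := hL.comp Primrec.fst
  have hz1 : Primrec fun x : α × ℕ => z x.1 := hz.comp Primrec.fst
  have hp1 : Primrec fun x : α × ℕ => p x.1 := hp.comp Primrec.fst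
  have hk1 : Primrec fun x : α × ℕ => k x.1 := hk.comp Primrec.fst
  have hs1 : Primrec fun x : α × ℕ => s x.1 := hs.comp Primrec.fst
  have hg : Primrec fun x : α × ℕ => (gd (L x.1) x.2).2 := Primrec.snd.comp (pr_gd hL1 Primrec.snd)
  refine pr_exists (Primrec.succ.comp hs) ?_
  refine PrimrecPred.and (Primrec.eq.comp (Primrec.fst.comp (Primrec.snd.comp hg)) (pr_zc hz1)) ?_
  refine PrimrecPred.and (Primrec.eq.comp (Primrec.fst.comp hg) hp1) ?_
  refine PrimrecPred.and (Primrec.eq.comp (Primrec.snd.comp (Primrec.snd.comp hg)) hk1) ?_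
  exact Primrec.eq.comp (P.pr_restr hz1 Primrec.snd (P.pr_len_out hk1))
    (P.pr_restr hz1 hs1 (P.pr_len_out hk1))

theorem pr_tt {L : α → List Rc} {z : α → Bool} {u : α → ℕ} (hL : Primrec L)
    (hz : Primrec z) (hu : Primrec u) : Primrec fun a => P.tt (gd (L a)) (z a) (u a) := by
  have hL1 : Primrec fun x : α × ℕ => L x.1 := hL.comp Primrec.fst
  have hz1 : Primrec fun x : α × ℕ => z x.1 := hz.comp Primrec.fst
  have hu1 : Primrec fun x : α × ℕ => u x.1 := hu.comp Primrec.fst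
  refine pr_lst (Primrec.succ.comp hu) ?_
  exact (P.pr_processed hL1 hz1 (Primrec.fst.comp (Primrec.snd.comp (pr_gd hL1 hu1)))
    Primrec.snd hu1).not

theorem pr_wset {L : α → List Rc} {z : α → Bool} {p t s v : α → ℕ} (hL : Primrec L)
    (hz : Primrec z) (hp : Primrec p) (ht : Primrec t) (hs : Primrec s) (hv : Primrec v) :
    PrimrecPred fun a => P.wset (gd (L a)) (z a) (p a) (t a) (s a) (v a) := by
  have hL1 : Primrec fun x : α × ℕ => L x.1 := hL.comp Primrec.fst
  have hz1 : Primrec fun x : α × ℕ => z x.1 := hz.comp Primrec.fst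
  have hp1 : Primrec fun x : α × ℕ => p x.1 := hp.comp Primrec.fst
  have ht1 : Primrec fun x : α × ℕ => t x.1 := ht.comp Primrec.fst
  have hv1 : Primrec fun x : α × ℕ => v x.1 := hv.comp Primrec.fst
  refine PrimrecPred.and (Primrec.eq.comp (pr_zOf.comp hv) hz) ?_
  refine PrimrecPred.and (P.pr_new hv) ?_
  refine PrimrecPred.and (P.pr_cur hz (pr_kOf.comp hv) hs) ?_
  refine pr_exists (Primrec.succ.comp hv) ?_
  refine PrimrecPred.and (Primrec.nat_lt.comp Primrec.snd (P.pr_len_out (pr_kOf.comp hv1))) ?_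
  refine PrimrecPred.and (pr_alive hL1 Primrec.snd (Primrec.succ.comp hv1)) ?_
  refine PrimrecPred.and (Primrec.eq.comp
    (Primrec.fst.comp (Primrec.snd.comp (pr_gd hL1 Primrec.snd))) hp1) ?_
  exact Primrec.eq.comp (P.pr_tt hL1 hz1 Primrec.snd) ht1

theorem kOf_le (s : ℕ) : kOf s ≤ s := by
  unfold kOf
  refine (Nat.unpair_left_le _).trans ?_
  rw [Nat.div2_val]; omega

theorem wt_nat (H : ℕ → Rc) (z : Bool) (p t s q : ℕ) :
    w2 q ≤ P.Wt H z p t s + w2 (P.len (kOf s)) ↔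
    2 ^ (s + 1) ≤ 2 ^ q * ((∑ a ∈ Finset.range s,
      if P.wset H z p t s a then 2 ^ (s + 1 - P.len (kOf a)) else 0) +
        2 ^ (s + 1 - P.len (kOf s))) := by
  have key : ∀ l ≤ s + 1, ((2 : ℝ) ^ (s + 1 - l)) = w2 l * 2 ^ (s + 1) := by
    intro l hl
    have h1 := w2_mul_pow l
    have h2 : (2 : ℝ) ^ (s + 1) = 2 ^ (s + 1 - l) * 2 ^ l := by rw [← pow_add]; congr 1; omega
    rw [h2]; linear_combination (- (2 : ℝ) ^ (s + 1 - l)) * h1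
  have hcast : (((∑ a ∈ Finset.range s,
      if P.wset H z p t s a then 2 ^ (s + 1 - P.len (kOf a)) else 0) +
        2 ^ (s + 1 - P.len (kOf s)) : ℕ) : ℝ) =
        (P.Wt H z p t s + w2 (P.len (kOf s))) * 2 ^ (s + 1) := by
    push_cast
    rw [add_mul, Wt, Finset.sum_mul]
    congr 1
    · refine Finset.sum_congr rfl fun a ha => ?_
      have ha' := Finset.mem_range.1 ha
      split_ifs with h
      · push_cast
        exact key _ (by have := P.hlen (kOf a); have := kOf_le a; omega)
      · simp
    · exact key _ (by have := P.hlen (kOf s); have := kOf_le s; omega)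
  rw [← Nat.cast_le (α := ℝ), Nat.cast_mul, hcast]
  push_cast
  have h1 : (0 : ℝ) < 2 ^ q := by positivity
  have h2 : (0 : ℝ) < 2 ^ (s + 1) := by positivity
  rw [← mul_assoc, w2_eq, div_le_iff₀ h1]
  constructor
  · intro h; nlinarith
  · intro h
    by_contra h3
    push Not at h3
    nlinarith

theorem pr_wantT {L : α → List Rc} {u s : α → ℕ} (hL : Primrec L) (hu : Primrec u)
    (hs : Primrec s) : PrimrecPred fun a => P.wantT (gd (L a)) (u a) (s a) := by
  have hL1 : Primrec fun x : α × ℕ => L x.1 := hL.comp Primrec.fst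
  have hu1 : Primrec fun x : α × ℕ => u x.1 := hu.comp Primrec.fst
  have hs1 : Primrec fun x : α × ℕ => s x.1 := hs.comp Primrec.fst
  have hp : Primrec fun a => (gd (L a) (u a)).2.1 := Primrec.fst.comp (Primrec.snd.comp (pr_gd hL hu))
  have hz : Primrec fun a => zOf (s a) := pr_zOf.comp hs
  have ht : Primrec fun a => P.tt (gd (L a)) (zOf (s a)) (u a) := P.pr_tt hL hz hu
  refine PrimrecPred.and (P.pr_new hs) (PrimrecPred.and
    (Primrec.nat_lt.comp hu (P.pr_len_out (pr_kOf.comp hs))) ?_)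
  simp only [wt_nat]
  have hpow {γ : Type _} [Primcodable γ] {f : γ → ℕ} (hf : Primrec f) : Primrec fun a => 2 ^ f a :=
    primrec_pow2.comp hf
  refine Primrec.nat_le.comp (hpow (Primrec.succ.comp hs)) (Primrec.nat_mul.comp
    (hpow (Primrec.nat_add.comp (P.lenP.comp ht) hp)) (Primrec.nat_add.comp ?_
      (hpow (Primrec.nat_sub.comp (Primrec.succ.comp hs) (P.lenP.comp (pr_kOf.comp hs))))))
  refine pr_sum hs (Primrec.ite ?_ ?_ (Primrec.const 0))
  · exact P.pr_wset hL1 (hz.comp Primrec.fst) (hp.comp Primrec.fst) (ht.comp Primrec.fst) hs1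
      Primrec.snd
  · exact primrec_pow2.comp (Primrec.nat_sub.comp (Primrec.succ.comp hs1)
      (P.lenP.comp (pr_kOf.comp Primrec.snd)))

theorem pr_zeroStr {n : α → ℕ} (hn : Primrec n) : Primrec fun a => zeroStr (n a) := by
  have : Primrec fun a => (List.range (n a)).map (fun _ => false) :=
    Primrec.list_map (Primrec.list_range.comp hn) (Primrec.const false)
  exact this.of_eq fun a => by simp [zeroStr]

theorem pr_wantX {L : α → List Rc} {u s : α → ℕ} (z : Bool) (hL : Primrec L) (hu : Primrec u)
    (hs : Primrec s) : PrimrecPred fun a => P.wantX (gd (L a)) (u a) (s a) z := by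
  have hp : Primrec fun a => (gd (L a) (u a)).2.1 := Primrec.fst.comp (Primrec.snd.comp (pr_gd hL hu))
  refine pr_forall hu (pr_exists (hs.comp Primrec.fst) (PrimrecPred.and ?_
    (pr_forall ((hs.comp Primrec.fst).comp Primrec.fst) (pr_imp ?_ ?_))))
  · exact Primrec.eq.comp (P.outP.comp Primrec.snd) (P.pr_restr (Primrec.const z)
      ((hs.comp Primrec.fst).comp Primrec.fst) (Primrec.snd.comp Primrec.fst))
  · exact Primrec.eq.comp (P.outP.comp Primrec.snd)
      (pr_zeroStr (Primrec.snd.comp (Primrec.fst.comp Primrec.fst)))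
  · exact Primrec.nat_le.comp (P.lenP.comp (Primrec.snd.comp Primrec.fst))
      (Primrec.nat_add.comp (P.lenP.comp Primrec.snd) (Primrec.nat_mul.comp (Primrec.const 2)
        (((hp.comp Primrec.fst).comp Primrec.fst).comp Primrec.fst)))

theorem pr_want {L : α → List Rc} {u s : α → ℕ} (hL : Primrec L) (hu : Primrec u)
    (hs : Primrec s) : PrimrecPred fun a => P.want (gd (L a)) (u a) (s a) := by
  have hi : Primrec fun a => (gd (L a) (u a)).1 := Primrec.fst.comp (pr_gd hL hu)
  refine PrimrecPred.and (pr_alive hL hu hs) (PrimrecPred.or (PrimrecPred.and ?_ ?_)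
    (PrimrecPred.or (PrimrecPred.or (P.pr_wantX _ hL hu hs) (P.pr_wantX _ hL hu hs))
      (P.pr_wantT hL hu hs)))
  · exact Primrec.eq.comp (hal_primrec.comp hi hu) (Primrec.const false)
  · exact Primrec.eq.comp (hal_primrec.comp hi hs) (Primrec.const true)

theorem pr_chs {L : α → List Rc} {s : α → ℕ} (hL : Primrec L) 
    (hs : Primrec s) : Primrec fun a => P.chs (gd (L a)) (s a) :=
  pr_lst hs (P.pr_want (hL.comp Primrec.fst) Primrec.snd (hs.comp Primrec.fst))

theorem pr_step {L : α → List Rc} {s : α → ℕ} (hL : Primrec L) 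
    (hs : Primrec s) : Primrec fun a => P.step (s a) (gd (L a)) := by
  have hc := P.pr_chs hL hs
  have hg := pr_gd hL hc
  refine Primrec.ite (Primrec.nat_lt.comp hc hs) ?_ ?_
  · refine Primrec.pair (Primrec.fst.comp hg) (Primrec.pair (Primrec.fst.comp
      (Primrec.snd.comp hg)) (Primrec.pair ?_ ?_))
    · exact Primrec.ite (P.pr_wantT hL hc hs) (pr_zc (pr_zOf.comp hs)) (Primrec.const 0)
    · exact P.pr_tt hL (pr_zOf.comp hs) hc
  · refine Primrec.pair (Primrec.ite (Primrec.eq.comp hs (Primrec.const 0)) (Primrec.const 0)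
      (Primrec.succ.comp (Primrec.fst.comp (pr_gd hL (Primrec.pred.comp hs))))) ?_
    exact Primrec.pair hs (Primrec.const (0, 0))

end

theorem F_primrec : Primrec P.F := by
  have : Primrec₂ fun (_ : Unit) => P.F := by
    refine Primrec.nat_strong_rec _
      (g := fun _ L => Option.some (P.step L.length (gd L))) ?_ ?_
    · exact Primrec.option_some.comp (P.pr_step Primrec.snd (Primrec.list_length.comp Primrec.snd))
    · intro _ n
      congr 1
      rw [F_eq, List.length_map, List.length_range]
      refine P.step_congr fun m hm => ?_
      simp [gd, hm]
  exact this.comp (Primrec.const ()) Primrec.id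

end Par

/-! ### Part 6: combinatorics of the construction -/

namespace Par
variable (P : Par)

noncomputable def ix (s : ℕ) : ℕ := (P.F s).1
noncomputable def pd (s : ℕ) : ℕ := (P.F s).2.1
noncomputable def fl (s : ℕ) : ℕ := (P.F s).2.2.1
noncomputable def pt (s : ℕ) : ℕ := (P.F s).2.2.2
noncomputable def ch (s : ℕ) : ℕ := P.chs P.F s
def al (u s : ℕ) : Prop := alive P.F u s
noncomputable def ti (z : Bool) (u : ℕ) : ℕ := P.tt P.F z u

theorem al_def {u s} : P.al u s ↔ u < s ∧ ∀ v < s, u < v → P.ix u < P.ix v := Iff.rfl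

theorem act_ix {s} (h : P.ch s < s) : P.ix s = P.ix (P.ch s) := by
  unfold ch at h; unfold ix ch; rw [P.F_eq s, step, if_pos h]
theorem act_pd {s} (h : P.ch s < s) : P.pd s = P.pd (P.ch s) := by
  unfold ch at h; unfold pd ch; rw [P.F_eq s, step, if_pos h]
theorem act_fl {s} (h : P.ch s < s) :
    P.fl s = if P.wantT P.F (P.ch s) s then zc (zOf s) else 0 := by
  unfold ch at h; unfold fl ch; rw [P.F_eq s, step, if_pos h]
theorem act_pt {s} (h : P.ch s < s) : P.pt s = P.ti (zOf s) (P.ch s) := by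
  unfold ch at h; unfold pt ch; rw [P.F_eq s, step, if_pos h]; rfl
theorem act_want {s} (h : P.ch s < s) : P.want P.F (P.ch s) s := lst_spec h
theorem not_want {s u} (h : u < P.ch s) : ¬ P.want P.F u s :=
  lst_min (Q := fun u => P.want P.F u s) h
theorem ch_le (s) : P.ch s ≤ s := lst_le _ _

theorem app_ix {s} (h : ¬ P.ch s < s) : P.ix s = if s = 0 then 0 else P.ix (s - 1) + 1 := by
  unfold ch at h; unfold ix; rw [P.F_eq s, step, if_neg h]
theorem app_pd {s} (h : ¬ P.ch s < s) : P.pd s = s := by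
  unfold ch at h; unfold pd; rw [P.F_eq s, step, if_neg h]
theorem app_fl {s} (h : ¬ P.ch s < s) : P.fl s = 0 := by
  unfold ch at h; unfold fl; rw [P.F_eq s, step, if_neg h]

theorem act_al {s} (h : P.ch s < s) : P.al (P.ch s) s := (P.act_want h).1

theorem al_mono {u s s'} (h : P.al u s') (hs : s ≤ s') (hu : u < s) : P.al u s :=
  ⟨hu, fun v hv huv => h.2 v (by omega) huv⟩

theorem al_lt {u s} (h : P.al u s) : u < s := h.1

theorem al_ix_lt {u u' s} (h : P.al u s) (h' : u' < s) (hu : u < u') : P.ix u < P.ix u' :=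
  h.2 u' h' hu

theorem dead {u s} (h : P.ch s < s) (hu : P.ch s ≤ u) (hus : u < s) : ¬ P.al u (s + 1) := by
  intro ha
  have h1 := P.al_ix_lt ha (Nat.lt_succ_self s) hus
  rw [P.act_ix h] at h1
  rcases hu.lt_or_eq with h2 | h2
  · have := P.al_ix_lt (P.act_al h) hus h2
    omega
  · rw [h2] at h1; exact lt_irrefl _ h1

theorem al_lt_ch {u s} (ha : P.al u (s + 1)) (hus : u < s) : u < P.ch s := by
  by_contra h
  push Not at h
  exact P.dead (by omega) h hus ha

theorem al_last {s} : P.al s (s + 1) := ⟨Nat.lt_succ_self s, fun v hv h => by omega⟩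

theorem al_succ {u s} (ha : P.al u s) (h : u < P.ch s) : P.al u (s + 1) := by
  have hu := P.al_lt ha
  refine ⟨by omega, fun v hv huv => ?_⟩
  rcases Nat.lt_or_ge v s with h1 | h1
  · exact ha.2 v h1 huv
  · have : v = s := by omega
    subst this
    change P.ix u < P.ix v
    by_cases h2 : P.ch v < v
    · rw [P.act_ix h2]; exact P.al_ix_lt ha h2 h
    · rw [P.app_ix h2, if_neg (by omega)]
      rcases Nat.lt_or_ge u (v - 1) with h3 | h3
      · have := P.al_ix_lt ha (show v - 1 < v by omega) h3; omega
      · have : u = v - 1 := by omega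
        rw [← this]; omega

theorem inv (w : ℕ) : P.pd w ≤ w ∧ P.ix (P.pd w) = P.ix w ∧
    (∀ v, P.pd w ≤ v → v ≤ w → P.ix w ≤ P.ix v) ∧ P.ix w ≤ P.pd w := by
  induction w using Nat.strong_induction_on with
  | _ s ih =>
    by_cases h : P.ch s < s
    · obtain ⟨h1, h2, h3, h4⟩ := ih _ h
      rw [P.act_pd h, P.act_ix h]
      refine ⟨by omega, h2, fun v hv hvs => ?_, h4⟩
      rcases Nat.lt_or_ge (P.ch s) v with h5 | h5
      · rcases hvs.lt_or_eq with h6 | h6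
        · exact (P.al_ix_lt (P.act_al h) h6 h5).le
        · rw [h6, P.act_ix h]
      · exact h3 v hv h5
    · rw [P.app_pd h]
      refine ⟨le_rfl, rfl, fun v hv hvs => by rw [le_antisymm hv hvs], ?_⟩
      rw [P.app_ix h]
      split_ifs with h0
      · omega
      · obtain ⟨h1, h2, h3, h4⟩ := ih (s - 1) (by omega)
        omega

theorem pd_le (w) : P.pd w ≤ w := (P.inv w).1
theorem ix_le (w) : P.ix w ≤ P.pd w := (P.inv w).2.2.2

theorem lt_pd {u u' s} (h : P.al u s) (h' : u' < s) (hu : u < u') : u < P.pd u' := by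
  by_contra hc
  push Not at hc
  have h1 := (P.inv u').2.2.1 u hc hu.le
  have h2 := P.al_ix_lt h h' hu
  omega

theorem al_inj {u u' s} (h : P.al u s) (h' : P.al u' s) (hp : P.pd u = P.pd u') : u = u' := by
  rcases lt_trichotomy u u' with h1 | h1 | h1
  · have := P.lt_pd h (P.al_lt h') h1
    have := P.pd_le u; omega
  · exact h1
  · have := P.lt_pd h' (P.al_lt h) h1
    have := P.pd_le u'; omega

/-! versions -/

theorem restr_length (z s n) : (P.restr z s n).length = n := by simp [restr]

theorem restr_eq_iff {z s t n} : P.restr z s n = P.restr z t n ↔ ∀ i < n, P.e z s i = P.e z t i := by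
  unfold restr
  rw [List.map_inj_left]
  simp

theorem restr_between {z a b s n} (hab : a ≤ b) (hbs : b ≤ s)
    (h : P.restr z a n = P.restr z s n) : P.restr z b n = P.restr z s n := by
  rw [restr_eq_iff] at h ⊢
  intro i hi
  have h1 := h i hi
  have h2 := P.emono z a b i hab
  have h3 := P.emono z b s i hbs
  cases ha : P.e z a i <;> cases hb : P.e z b i <;> cases hs : P.e z s i <;> simp_all

theorem restr_prefix {z a s n m} (hm : m ≤ n)
    (h : P.restr z a n = P.restr z s n) : P.restr z a m = P.restr z s m := by
  rw [restr_eq_iff] at h ⊢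
  exact fun i hi => h i (by omega)

theorem cur_restr {z k a s} (h : P.cur z k a) (h' : P.cur z k s) :
    P.restr z a (P.out k).length = P.restr z s (P.out k).length := by
  unfold cur at h h'; rw [← h, ← h']

theorem cur_between {z k a b s} (hab : a ≤ b) (hbs : b ≤ s) (h : P.cur z k a) (h' : P.cur z k s) :
    P.cur z k b := by
  have := P.restr_between hab hbs (P.cur_restr h h')
  unfold cur at h' ⊢
  rw [this]; exact h'

theorem new_cur {a} (h : P.new a) : P.cur (zOf a) (kOf a) a := h.1

theorem new_inj {a b} (ha : P.new a) (hb : P.new b) (hz : zOf a = zOf b) (hk : kOf a = kOf b) :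
    a = b := by
  rcases lt_trichotomy a b with h | h | h
  · exact absurd (hk ▸ hz ▸ ha.1) (hb.2 a h hz hk)
  · exact h
  · exact absurd (hk ▸ hz ▸ hb.1) (ha.2 b h hz.symm hk.symm)

theorem sum_new (z : Bool) (S : Finset ℕ) (hS : ∀ a ∈ S, P.new a ∧ zOf a = z) :
    ∑ a ∈ S, w2 (P.len (kOf a)) ≤ 2 := by
  have := P.hsum (S.image kOf)
  rwa [Finset.sum_image] at this
  intro a ha b hb hab
  exact P.new_inj (hS a ha).1 (hS b hb).1 (by rw [(hS a ha).2, (hS b hb).2]) hab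

theorem out_lt (s) : (P.out (kOf s)).length ≤ s := (P.hout _).trans (kOf_le s)

/-! requests for `N` -/

theorem zc_ne (z) : zc z ≠ 0 := by cases z <;> decide
theorem zc_inj {z z'} (h : zc z = zc z') : z = z' := by
  cases z <;> cases z' <;> first | rfl | (simp [zc] at h)

theorem fl_spec {s z} (h : P.fl s = zc z) : P.ch s < s ∧ zOf s = z ∧ P.wantT P.F (P.ch s) s := by
  have h1 : P.ch s < s := by
    by_contra hc
    rw [P.app_fl hc] at h
    exact zc_ne z h.symm
  rw [P.act_fl h1] at h
  split_ifs at h with h2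
  · exact ⟨h1, zc_inj h, h2⟩
  · exact absurd h.symm (zc_ne z)

theorem ti_le (z u) : P.ti z u ≤ u := by
  induction u using Nat.strong_induction_on generalizing z with
  | _ u ih =>
    refine Nat.le_of_lt_succ (lst_lt (i := u) (Nat.lt_succ_self u) ?_)
    rintro ⟨s', hs', h1, h2, h3, -⟩
    have h4 := P.fl_spec (z := z) h1
    have h5 : P.pt s' = u := h3
    rw [P.act_pt h4.1] at h5
    have := ih (P.ch s') (by omega) (zOf s')
    omega

theorem ti_spec (z u) : ¬ P.processed P.F z (P.pd u) (P.ti z u) u :=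
  lst_spec (Q := fun k => ¬ P.processed P.F z (P.F u).2.1 k u) (Nat.lt_succ_of_le (P.ti_le z u))

theorem ti_min {z u k} (h : k < P.ti z u) : P.processed P.F z (P.pd u) k u := by
  have := lst_min (Q := fun k => ¬ P.processed P.F z (P.F u).2.1 k u) (b := u + 1) h
  exact not_not.1 this

/-- weight -/
noncomputable def W (z : Bool) (p t s : ℕ) : ℝ := P.Wt P.F z p t s
def ws (z : Bool) (p t s a : ℕ) : Prop := P.wset P.F z p t s a

theorem ws_iff {z p t s a} : P.ws z p t s a ↔ zOf a = z ∧ P.new a ∧ P.cur z (kOf a) s ∧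
    ∃ u < a + 1, u < (P.out (kOf a)).length ∧ P.al u (a + 1) ∧ P.pd u = p ∧ P.ti z u = t := Iff.rfl

theorem W_eq (z p t s) :
    P.W z p t s = ∑ a ∈ Finset.range s, if P.ws z p t s a then w2 (P.len (kOf a)) else 0 := rfl

theorem wantT_iff {u s} : P.wantT P.F u s ↔ P.new s ∧ u < (P.out (kOf s)).length ∧
    w2 (P.len (P.ti (zOf s) u) + P.pd u) ≤
      P.W (zOf s) (P.pd u) (P.ti (zOf s) u) s + w2 (P.len (kOf s)) := Iff.rfl

theorem W_lt (z p t s) : P.W z p t s < w2 (P.len t + p) := by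
  induction s with
  | zero => rw [W_eq]; simpa using w2_pos _
  | succ s ih =>
    have hle : ∑ a ∈ Finset.range s, (if P.ws z p t (s + 1) a then w2 (P.len (kOf a)) else 0) ≤
        P.W z p t s := by
      rw [W_eq]
      refine Finset.sum_le_sum fun a ha => ?_
      have ha' := Finset.mem_range.1 ha
      split_ifs with h1 h2 h2
      · exact le_rfl
      · exfalso; apply h2
        rw [ws_iff] at h1 ⊢
        obtain ⟨h3, h4, h5, h6⟩ := h1
        exact ⟨h3, h4, P.cur_between ha'.le (Nat.le_succ s) (h3 ▸ P.new_cur h4) h5, h6⟩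
      · exact w2_nonneg _
      · exact le_rfl
    rw [W_eq, Finset.sum_range_succ]
    split_ifs with h1
    · obtain ⟨h3, h4, h5, u, h6, h7, h8, h9, h10⟩ := P.ws_iff.1 h1
      have hus : u < s := by have := P.out_lt s; omega
      have hw := P.not_want (P.al_lt_ch h8 hus)
      have has := P.al_mono h8 (Nat.le_succ s) hus
      have hT : ¬ P.wantT P.F u s := fun h => hw ⟨has, Or.inr (Or.inr h)⟩
      rw [wantT_iff] at hT
      push Not at hT
      have := hT h4 h7
      rw [h3, h9, h10] at this
      linarith
    · linarith

def nreq (z : Bool) (p s : ℕ) : Prop := P.fl s = zc z ∧ P.pd s = p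

noncomputable def nset (z : Bool) (p s : ℕ) : Finset ℕ :=
  (Finset.range (s + 1)).filter fun a => a = s ∨ P.ws z p (P.pt s) s a

theorem nset_disj {z p s1 s2} (h1 : P.nreq z p s1) (h2 : P.nreq z p s2) (h : s1 < s2) :
    Disjoint (P.nset z p s1) (P.nset z p s2) := by
  rw [Finset.disjoint_left]
  intro a ha1 ha2
  simp only [nset, Finset.mem_filter, Finset.mem_range] at ha1 ha2
  obtain ⟨hc1, hz1, hT1⟩ := P.fl_spec h1.1
  obtain ⟨hc2, hz2, hT2⟩ := P.fl_spec h2.1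
  have hp1 : P.pd (P.ch s1) = p := by rw [← P.act_pd hc1]; exact h1.2
  have hp2 : P.pd (P.ch s2) = p := by rw [← P.act_pd hc2]; exact h2.2
  have hw2 : P.ws z p (P.pt s2) s2 a := by
    rcases ha2.2 with h3 | h3
    · omega
    · exact h3
  obtain ⟨b1, b2, b3, u', b4, b5, b6, b7, b8⟩ := P.ws_iff.1 hw2
  have hd1 : ∀ s', s1 < s' → ¬ P.al (P.ch s1) s' := fun s' hs' hal =>
    P.dead hc1 le_rfl hc1 (P.al_mono hal hs' (by omega))
  rcases ha1.2 with h3 | h3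
  · subst h3
    have : u' < a := by have := P.out_lt a; omega
    have h4 := P.al_mono b6 (Nat.le_succ a) this
    have h5 : u' = P.ch a := P.al_inj h4 (P.act_al hc1) (by rw [b7, hp1])
    subst h5
    exact hd1 _ (Nat.lt_succ_self a) b6
  · obtain ⟨c1, c2, c3, u'', c4, c5, c6, c7, c8⟩ := P.ws_iff.1 h3
    have h4 : u'' = u' := P.al_inj c6 b6 (by rw [c7, b7])
    subst h4
    have ht : P.pt s1 = P.pt s2 := by rw [← c8, b8]
    have ht2 : P.ti z (P.ch s2) = P.pt s2 := by rw [P.act_pt hc2, hz2]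
    rcases Nat.lt_or_ge (P.ch s2) s1 with h5 | h5
    · have h6 : P.ch s2 = P.ch s1 :=
        P.al_inj (P.al_mono (P.act_al hc2) h.le h5) (P.act_al hc1) (by rw [hp1, hp2])
      exact hd1 s2 h (h6 ▸ P.act_al hc2)
    · have h7 := P.ti_spec z (P.ch s2)
      apply h7
      refine ⟨s1, by omega, h1.1, by rw [hp2]; exact h1.2, by rw [ht2]; exact ht, ?_⟩
      rw [ht2]
      have h8 : P.restr z s1 (P.out (kOf a)).length = P.restr z s2 (P.out (kOf a)).length :=
        P.cur_restr c3 b3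
      have h9 : P.restr z (P.ch s2) (P.out (kOf a)).length = P.restr z s2 (P.out (kOf a)).length :=
        P.restr_between h5 hc2.le h8
      have h10 : (P.out (P.pt s2)).length ≤ (P.out (kOf a)).length := by
        have := P.hout (P.pt s2)
        have := P.ti_le z u''
        omega
      exact P.restr_prefix h10 (h8.trans h9.symm)

theorem nset_le {z p s} (h : P.nreq z p s) :
    w2 (P.len (P.pt s) + p) ≤ ∑ a ∈ P.nset z p s, w2 (P.len (kOf a)) := by
  obtain ⟨hc, hz, hT⟩ := P.fl_spec h.1
  obtain ⟨h1, h2, h3⟩ := P.wantT_iff.1 hT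
  rw [← P.act_pd hc, h.2, ← P.act_pt hc, hz] at h3
  refine h3.trans ?_
  rw [nset, Finset.sum_filter, Finset.sum_range_succ, if_pos (Or.inl rfl), W_eq]
  gcongr with a ha
  split_ifs with h4 h5 h5
  · exact le_rfl
  · exact absurd (Or.inr h4) h5
  · exact w2_nonneg _
  · exact le_rfl

theorem N_bound (z p n) :
    ∑ s ∈ Finset.range n, (if P.nreq z p s then w2 (P.len (P.pt s) + p) else 0) ≤ 2 := by
  rw [← Finset.sum_filter]
  calc _ ≤ ∑ s ∈ (Finset.range n).filter (P.nreq z p), ∑ a ∈ P.nset z p s, w2 (P.len (kOf a)) :=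
        Finset.sum_le_sum fun s hs => P.nset_le (Finset.mem_filter.1 hs).2
    _ = ∑ a ∈ ((Finset.range n).filter (P.nreq z p)).biUnion (P.nset z p), w2 (P.len (kOf a)) := by
        rw [Finset.sum_biUnion]
        intro s1 hs1 s2 hs2 hne
        have h1 := (Finset.mem_filter.1 hs1).2
        have h2 := (Finset.mem_filter.1 hs2).2
        rcases Nat.lt_or_gt_of_ne hne with h | h
        · exact P.nset_disj h1 h2 h
        · exact (P.nset_disj h2 h1 h).symm
    _ ≤ 2 := by
        refine P.sum_new z _ fun a ha => ?_
        rw [Finset.mem_biUnion] at ha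
        obtain ⟨s, hs, ha⟩ := ha
        obtain ⟨hc, hz, hT⟩ := P.fl_spec (Finset.mem_filter.1 hs).2.1
        simp only [nset, Finset.mem_filter, Finset.mem_range] at ha
        rcases ha.2 with h3 | h3
        · subst h3; exact ⟨hT.1, hz⟩
        · exact ⟨h3.2.1, h3.1⟩

end Par

/-! ### Part 7: the weight bound for `M` -/

theorem sum_unique {q : ℕ → Prop} [DecidablePred q] {r : Prop} [Decidable r] {c : ℝ} (n : ℕ) (hc : 0 ≤ c)
    (hq : ∀ s s', q s → q s' → s = s') (hr : ∀ s, q s → r) :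
    ∑ s ∈ Finset.range n, (if q s then c else 0) ≤ if r then c else 0 := by
  by_cases h : ∃ s ∈ Finset.range n, q s
  · obtain ⟨s, hs, hqs⟩ := h
    rw [Finset.sum_eq_single s]
    · rw [if_pos hqs, if_pos (hr s hqs)]
    · intro b _ hb
      rw [if_neg fun h => hb (hq _ _ h hqs)]
    · intro h; exact absurd hs h
  · push Not at h
    rw [Finset.sum_eq_zero]
    · split_ifs <;> simp [hc]
    · intro s hs; rw [if_neg (h s hs)]

theorem sum_w2_range (n : ℕ) : ∑ u ∈ Finset.range n, w2 u ≤ 2 := by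
  have h := geom_w2 n
  have h2 : ∑ u ∈ Finset.range n, w2 u = (∑ u ∈ Finset.range n, w2 (u + 1)) * 2 := by
    rw [Finset.sum_mul]
    exact Finset.sum_congr rfl fun u _ => (w2_succ u).symm
  linarith

theorem sum_w2_finset (S : Finset ℕ) : ∑ u ∈ S, w2 u ≤ 2 := by
  obtain ⟨n, hn⟩ := S.exists_nat_subset_range
  exact (Finset.sum_le_sum_of_subset_of_nonneg hn fun _ _ _ => w2_nonneg _).trans (sum_w2_range n)

theorem sum_w2_tail (u n : ℕ) : ∑ p ∈ (Finset.range n).filter (fun p => u < p), w2 p ≤ w2 u := by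
  have h1 : ∑ p ∈ (Finset.range n).filter (fun p => u < p), w2 p ≤
      ∑ k ∈ Finset.range n, w2 (u + (k + 1)) := by
    rw [← Finset.sum_image (s := Finset.range n) (g := fun k => u + (k + 1)) (f := w2)
      (fun a _ b _ h => by simpa using h)]
    refine Finset.sum_le_sum_of_subset_of_nonneg ?_ fun _ _ _ => w2_nonneg _
    intro p hp
    rw [Finset.mem_filter, Finset.mem_range] at hp
    rw [Finset.mem_image]
    exact ⟨p - u - 1, Finset.mem_range.2 (by omega), by omega⟩
  refine h1.trans ?_
  simp only [w2_add u]
  rw [← Finset.mul_sum]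
  have := geom_w2 n
  have := w2_nonneg u
  nlinarith

namespace Par
variable (P : Par)

noncomputable def bs (s n : ℕ) : Str := (List.range n).map fun i => decide (i < s ∧ ¬ P.al i s)

theorem bs_eq_iff {s t n} : P.bs s n = P.bs t n ↔
    ∀ i < n, ((i < s ∧ ¬ P.al i s) ↔ (i < t ∧ ¬ P.al i t)) := by
  unfold bs
  rw [List.map_inj_left]
  simp only [List.mem_range, decide_eq_decide]

theorem bs_change {s n} (h : P.bs (s + 1) n ≠ P.bs s n) : P.ch s < s ∧ P.ch s < n := by
  rw [Ne, bs_eq_iff] at h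
  push Not at h
  obtain ⟨i, hi, h⟩ := h
  have h1 : i < s := by
    by_contra hc
    rcases h with h | h
    · have : i = s := by omega
      subst this
      exact h.1.2 P.al_last
    · omega
  have h2 : P.al i s ∧ ¬ P.al i (s + 1) := by
    rcases h with h | h
    · exact ⟨h.2 h1, h.1.2⟩
    · exfalso
      exact h.2.2 (P.al_mono (h.1 (by omega)) (Nat.le_succ s) h1)
  have h3 : P.ch s ≤ i := by
    by_contra hc
    exact h2.2 (P.al_succ h2.1 (by omega))
  omega

def mreq (z : Bool) (a s : ℕ) : Prop := a ≤ s ∧ P.new a ∧ zOf a = z ∧ P.cur z (kOf a) s ∧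
  (a = s ∨ P.bs (s + 1) (P.out (kOf a)).length ≠ P.bs s (P.out (kOf a)).length)

def mfirst (z : Bool) (a s : ℕ) : Prop :=
  P.mreq z a s ∧ a < s ∧ ∀ s' < s, a < s' → ¬ P.mreq z a s'
def mrep (z : Bool) (a s : ℕ) : Prop :=
  P.mreq z a s ∧ a < s ∧ ∃ s' < s, a < s' ∧ P.mreq z a s'

theorem mreq_ch {z a s} (h : P.mreq z a s) (has : a < s) :
    P.ch s < s ∧ P.ch s < (P.out (kOf a)).length ∧ P.ch s < a := by
  obtain ⟨h1, h2, h3, h4, h5⟩ := h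
  have := P.bs_change (h5.resolve_left (by omega))
  have := P.out_lt a
  omega

theorem mrep_ws {z a s} (h : P.mrep z a s) :
    P.ch s < s ∧ ∃ v < s, P.ch s < P.pd v ∧ P.ws z (P.pd v) (P.ti z v) s a := by
  obtain ⟨h1, has, s', hs', has', h2⟩ := h
  obtain ⟨c1, c2, c3⟩ := P.mreq_ch h1 has
  obtain ⟨d1, d2, d3⟩ := P.mreq_ch h2 has'
  have hal : P.al (P.ch s) (a + 1) := P.al_mono (P.act_al c1) has (by omega)
  have hal' : P.al (P.ch s') (a + 1) := P.al_mono (P.act_al d1) has' (by omega)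
  have hlt : P.ch s < P.ch s' := by
    by_contra hc
    push Not at hc
    exact P.dead d1 hc (by omega) (P.al_mono (P.act_al c1) hs' (by omega))
  refine ⟨c1, P.ch s', by omega, P.lt_pd hal (P.al_lt hal') hlt, ?_⟩
  rw [ws_iff]
  exact ⟨h1.2.2.1, h1.2.1, h1.2.2.2.1, P.ch s', by omega, d2, hal', rfl, rfl⟩

theorem sum_W (z u s) : ∑ p ∈ (Finset.range s).filter (fun p => u < p), ∑ t ∈ Finset.range s,
    P.W z p t s ≤ 2 * w2 u := by
  calc _ ≤ ∑ p ∈ (Finset.range s).filter (fun p => u < p), 2 * w2 p := by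
        refine Finset.sum_le_sum fun p _ => ?_
        calc _ ≤ ∑ t ∈ Finset.range s, w2 (P.len t) * w2 p :=
              Finset.sum_le_sum fun t _ => by rw [← w2_add]; exact (P.W_lt z p t s).le
          _ = (∑ t ∈ Finset.range s, w2 (P.len t)) * w2 p := by rw [Finset.sum_mul]
          _ ≤ 2 * w2 p := mul_le_mul_of_nonneg_right (P.hsum _) (w2_nonneg _)
    _ ≤ 2 * w2 u := by
        rw [← Finset.mul_sum]
        have := sum_w2_tail u s
        linarith

theorem mrep_bound (z s m) : ∑ a ∈ Finset.range m, (if P.mrep z a s then w2 (P.len (kOf a)) else 0) ≤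
    if P.ch s < s then 2 * w2 (P.ch s) else 0 := by
  by_cases hc : P.ch s < s
  · rw [if_pos hc]
    refine le_trans ?_ (P.sum_W z (P.ch s) s)
    simp only [W_eq]
    calc _ ≤ ∑ a ∈ Finset.range s, (if P.mrep z a s then w2 (P.len (kOf a)) else 0) := by
          rw [← Finset.sum_filter, ← Finset.sum_filter]
          refine Finset.sum_le_sum_of_subset_of_nonneg ?_ fun _ _ _ => w2_nonneg _
          intro a ha
          rw [Finset.mem_filter] at ha ⊢
          exact ⟨Finset.mem_range.2 ha.2.2.1, ha.2⟩
      _ ≤ ∑ a ∈ Finset.range s, ∑ p ∈ (Finset.range s).filter (fun p => P.ch s < p),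
            ∑ t ∈ Finset.range s, (if P.ws z p t s a then w2 (P.len (kOf a)) else 0) := by
          refine Finset.sum_le_sum fun a ha => ?_
          have hnn : ∀ p t, 0 ≤ (if P.ws z p t s a then w2 (P.len (kOf a)) else 0) := by
            intro p t; split_ifs; exacts [w2_nonneg _, le_rfl]
          split_ifs with h
          · obtain ⟨-, v, hv, hv1, hv2⟩ := P.mrep_ws h
            have hp : P.pd v ∈ (Finset.range s).filter (fun p => P.ch s < p) :=
              Finset.mem_filter.2 ⟨Finset.mem_range.2 (by have := P.pd_le v; omega), hv1⟩
            have ht : P.ti z v ∈ Finset.range s :=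
              Finset.mem_range.2 (by have := P.ti_le z v; omega)
            refine le_trans ?_ (Finset.single_le_sum (f := fun p => ∑ t ∈ Finset.range s,
              (if P.ws z p t s a then w2 (P.len (kOf a)) else 0))
              (fun p _ => Finset.sum_nonneg fun t _ => hnn p t) hp)
            refine le_trans ?_ (Finset.single_le_sum (f := fun t =>
              (if P.ws z (P.pd v) t s a then w2 (P.len (kOf a)) else 0))
              (fun t _ => hnn _ t) ht)
            simp only [if_pos hv2, le_refl]
          · exact Finset.sum_nonneg fun p _ => Finset.sum_nonneg fun t _ => hnn p t
      _ = _ := by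
          rw [Finset.sum_comm]
          exact Finset.sum_congr rfl fun p _ => Finset.sum_comm
  · rw [if_neg hc]
    refine (Finset.sum_eq_zero fun a _ => if_neg fun h => hc (P.mrep_ws h).1).le

theorem ch_inj {s s'} (h : P.ch s < s) (h' : P.ch s' < s') (he : P.ch s = P.ch s') : s = s' := by
  rcases lt_trichotomy s s' with h1 | h1 | h1
  · exact absurd (P.al_mono (P.act_al h') h1 (by omega)) (P.dead h he.le (by omega))
  · exact h1
  · exact absurd (P.al_mono (P.act_al h) h1 (by omega)) (P.dead h' he.ge (by omega))

theorem sum_ch (n) : ∑ s ∈ Finset.range n, (if P.ch s < s then 2 * w2 (P.ch s) else 0) ≤ 4 := by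
  rw [← Finset.sum_filter, ← Finset.mul_sum, ← Finset.sum_image (f := w2) (g := P.ch)]
  · have := sum_w2_finset (((Finset.range n).filter fun s => P.ch s < s).image P.ch)
    linarith
  · intro s hs s' hs' he
    exact P.ch_inj (Finset.mem_filter.1 hs).2 (Finset.mem_filter.1 hs').2 he

theorem sum_new' (z n) : ∑ a ∈ Finset.range n,
    (if P.new a ∧ zOf a = z then w2 (P.len (kOf a)) else 0) ≤ 2 := by
  rw [← Finset.sum_filter]
  exact P.sum_new z _ fun a ha => (Finset.mem_filter.1 ha).2

theorem M_bound (z n m) : ∑ s ∈ Finset.range n, ∑ a ∈ Finset.range m,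
    (if P.mreq z a s then w2 (P.len (kOf a)) else 0) ≤ 8 := by
  have h1 : ∑ s ∈ Finset.range n, ∑ a ∈ Finset.range m,
    (if P.mreq z a s ∧ a = s then w2 (P.len (kOf s)) else 0) ≤ 2 := by
    refine le_trans (Finset.sum_le_sum fun s _ => sum_unique (q := fun a => P.mreq z a s ∧ a = s)
      (r := P.new s ∧ zOf s = z) m (w2_nonneg _)
      (fun a a' h h' => h.2.trans h'.2.symm) (fun a h => ?_)) (P.sum_new' z n)
    rw [← h.2]; exact ⟨h.1.2.1, h.1.2.2.1⟩
  have h2 : ∑ s ∈ Finset.range n, ∑ a ∈ Finset.range m,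
    (if P.mfirst z a s then w2 (P.len (kOf a)) else 0) ≤ 2 := by
    rw [Finset.sum_comm]
    refine le_trans (Finset.sum_le_sum fun a _ => sum_unique (q := fun s => P.mfirst z a s)
      (r := P.new a ∧ zOf a = z) n (w2_nonneg _)
      (fun s s' h h' => ?_) (fun s h => ⟨h.1.2.1, h.1.2.2.1⟩)) (P.sum_new' z m)
    rcases lt_trichotomy s s' with h3 | h3 | h3
    · exact absurd h.1 (h'.2.2 s h3 h.2.1)
    · exact h3
    · exact absurd h'.1 (h.2.2 s' h3 h'.2.1)
  have h3 : ∑ s ∈ Finset.range n, ∑ a ∈ Finset.range m,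
    (if P.mrep z a s then w2 (P.len (kOf a)) else 0) ≤ 4 :=
    le_trans (Finset.sum_le_sum fun s _ => P.mrep_bound z s m) (P.sum_ch n)
  have h4 : ∑ s ∈ Finset.range n, ∑ a ∈ Finset.range m,
    (if P.mreq z a s then w2 (P.len (kOf a)) else 0) ≤ ∑ s ∈ Finset.range n, ∑ a ∈ Finset.range m,
      ((if P.mreq z a s ∧ a = s then w2 (P.len (kOf s)) else 0) +
      (if P.mfirst z a s then w2 (P.len (kOf a)) else 0) +
      (if P.mrep z a s then w2 (P.len (kOf a)) else 0)) := by
    refine Finset.sum_le_sum fun s _ => Finset.sum_le_sum fun a _ => ?_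
    have p1 : 0 ≤ (if P.mreq z a s ∧ a = s then w2 (P.len (kOf s)) else 0) := by
      split_ifs; exacts [w2_nonneg _, le_rfl]
    have p2 : 0 ≤ (if P.mfirst z a s then w2 (P.len (kOf a)) else 0) := by
      split_ifs; exacts [w2_nonneg _, le_rfl]
    have p3 : 0 ≤ (if P.mrep z a s then w2 (P.len (kOf a)) else 0) := by
      split_ifs; exacts [w2_nonneg _, le_rfl]
    by_cases h : P.mreq z a s
    · rw [if_pos h]
      rcases h.1.lt_or_eq with h5 | h5
      · by_cases h6 : ∃ s' < s, a < s' ∧ P.mreq z a s'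
        · rw [if_pos (show P.mrep z a s from ⟨h, h5, h6⟩)]; linarith
        · push Not at h6
          rw [if_pos (show P.mfirst z a s from ⟨h, h5, h6⟩)]; linarith
      · rw [if_pos (show P.mreq z a s ∧ a = s from ⟨h, h5⟩), ← h5]
        rw [← h5] at p2 p3; linarith
    · rw [if_neg h]; linarith
  simp only [Finset.sum_add_distrib] at h4
  linarith

end Par

/-! ### Part 8: Kraft-Chaitin consequences -/

theorem sum_unpair {f : ℕ → ℕ → ℝ} (hf : ∀ a b, 0 ≤ f a b) {C : ℝ}
    (h : ∀ n m, ∑ s ∈ Finset.range n, ∑ a ∈ Finset.range m, f a s ≤ C) (n : ℕ) :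
    ∑ k ∈ Finset.range n, f k.unpair.1 k.unpair.2 ≤ C := by
  refine le_trans ?_ (h n n)
  rw [Finset.sum_comm, ← Finset.sum_product']
  rw [← Finset.sum_image (s := Finset.range n) (g := Nat.unpair) (f := fun x => f x.1 x.2)]
  · refine Finset.sum_le_sum_of_subset_of_nonneg ?_ fun x _ _ => hf _ _
    intro x hx
    obtain ⟨k, hk, rfl⟩ := Finset.mem_image.1 hx
    rw [Finset.mem_range] at hk
    rw [Finset.mem_product, Finset.mem_range, Finset.mem_range]
    exact ⟨(Nat.unpair_left_le k).trans_lt hk, (Nat.unpair_right_le k).trans_lt hk⟩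
  · intro a _ b _ hab
    have := congrArg (fun x : ℕ × ℕ => Nat.pair x.1 x.2) hab
    simpa using this

noncomputable def ka (U : Str →. Str) (σ : Str) : ℕ := (KC U σ).toNat

theorem ka_eq {U : Str →. Str} (hU : OptimalPF U) (σ : Str) : (ka U σ : ℕ∞) = KC U σ :=
  ENat.natCast_toNat (KC_ne_top hU σ)

namespace Par
variable (P : Par)

section
variable {α : Type*} [Primcodable α]

theorem ixP : Primrec P.ix := Primrec.fst.comp P.F_primrec
theorem pdP : Primrec P.pd := Primrec.fst.comp (Primrec.snd.comp P.F_primrec)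
theorem flP : Primrec P.fl := Primrec.fst.comp (Primrec.snd.comp (Primrec.snd.comp P.F_primrec))
theorem ptP : Primrec P.pt := Primrec.snd.comp (Primrec.snd.comp (Primrec.snd.comp P.F_primrec))

theorem alP {u s : α → ℕ} (hu : Primrec u) (hs : Primrec s) :
    PrimrecPred fun a => P.al (u a) (s a) := by
  have hu1 : Primrec fun x : α × ℕ => u x.1 := hu.comp Primrec.fst
  refine PrimrecPred.and (Primrec.nat_lt.comp hu hs) (pr_forall hs ?_)
  refine pr_imp (Primrec.nat_lt.comp hu1 Primrec.snd) ?_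
  exact Primrec.nat_lt.comp (P.ixP.comp hu1) (P.ixP.comp Primrec.snd)

theorem bsP {s n : α → ℕ} (hs : Primrec s) (hn : Primrec n) :
    Primrec fun a => P.bs (s a) (n a) := by
  refine Primrec.list_map (Primrec.list_range.comp hn) ?_
  refine PrimrecPred.decide ?_
  have hs1 : Primrec fun x : α × ℕ => s x.1 := hs.comp Primrec.fst
  exact PrimrecPred.and (Primrec.nat_lt.comp Primrec.snd hs1) (P.alP Primrec.snd hs1).not

theorem mreqP (z : Bool) {a s : α → ℕ} (ha : Primrec a) (hs : Primrec s) :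
    PrimrecPred fun x => P.mreq z (a x) (s x) := by
  have hn := P.pr_len_out (pr_kOf.comp ha)
  refine PrimrecPred.and (Primrec.nat_le.comp ha hs) (PrimrecPred.and (P.pr_new ha)
    (PrimrecPred.and (Primrec.eq.comp (pr_zOf.comp ha) (Primrec.const z))
    (PrimrecPred.and (P.pr_cur (Primrec.const z) (pr_kOf.comp ha) hs) (PrimrecPred.or
    (Primrec.eq.comp ha hs) (PrimrecPred.not ?_)))))
  exact Primrec.eq.comp (P.bsP (Primrec.succ.comp hs) hn) (P.bsP hs hn)

theorem nreqP (z : Bool) (p : ℕ) : PrimrecPred (P.nreq z p) :=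
  PrimrecPred.and (Primrec.eq.comp P.flP (Primrec.const _)) (Primrec.eq.comp P.pdP (Primrec.const _))

end

def qreq (u k : ℕ) : Prop :=
  (P.out k).length ≤ u ∧ ∀ u' < u, P.pd u' = P.pd u → u' < (P.out k).length

theorem qreqP {α : Type*} [Primcodable α] {u k : α → ℕ} (hu : Primrec u) (hk : Primrec k) :
    PrimrecPred fun x => P.qreq (u x) (k x) := by
  refine PrimrecPred.and (Primrec.nat_le.comp (P.pr_len_out hk) hu) (pr_forall hu (pr_imp ?_ ?_))
  · exact Primrec.eq.comp (P.pdP.comp Primrec.snd) (P.pdP.comp (hu.comp Primrec.fst))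
  · exact Primrec.nat_lt.comp Primrec.snd (P.pr_len_out (hk.comp Primrec.fst))

theorem Q_bound (n m) : ∑ k ∈ Finset.range n, ∑ u ∈ Finset.range m,
    (if P.qreq u k then w2 (P.len k + P.pd u) else 0) ≤ 4 := by
  have h1 : ∀ k, ∑ u ∈ Finset.range m,
      (if P.qreq u k then w2 (P.len k + P.pd u) else 0) ≤ w2 (P.len k) * 2 := by
    intro k
    rw [← Finset.sum_filter]
    simp only [w2_add]
    rw [← Finset.mul_sum]
    refine mul_le_mul_of_nonneg_left ?_ (w2_nonneg _)
    rw [← Finset.sum_image (f := w2) (g := P.pd)]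
    · exact sum_w2_finset _
    · intro a ha b hb hab
      have ha' := (Finset.mem_filter.1 ha).2
      have hb' := (Finset.mem_filter.1 hb).2
      rcases lt_trichotomy a b with h | h | h
      · have := hb'.2 a h hab; have := ha'.1; omega
      · exact h
      · have := ha'.2 b h hab.symm; have := hb'.1; omega
  refine (Finset.sum_le_sum fun k _ => h1 k).trans ?_
  rw [← Finset.sum_mul]
  have := P.hsum (Finset.range n)
  linarith



theorem M_kc {U : Str →. Str} (hU : OptimalPF U) (z : Bool) : ∃ c : ℕ, ∀ a s, P.mreq z a s →
    KC U (P.bs (s + 1) (P.out (kOf a)).length) ≤ (P.len (kOf a) : ℕ∞) + c := by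
  have hr : Primrec fun k : ℕ => if P.mreq z k.unpair.1 k.unpair.2 then
      Option.some (P.len (kOf k.unpair.1), P.bs (k.unpair.2 + 1) (P.out (kOf k.unpair.1)).length)
      else Option.none := by
    have h1 : Primrec fun k : ℕ => k.unpair.1 := Primrec.fst.comp Primrec.unpair
    have h2 : Primrec fun k : ℕ => k.unpair.2 := Primrec.snd.comp Primrec.unpair
    exact Primrec.ite (P.mreqP z h1 h2) (Primrec.option_some.comp (Primrec.pair
      (P.lenP.comp (pr_kOf.comp h1)) (P.bsP (Primrec.succ.comp h2) (P.pr_len_out (pr_kOf.comp h1)))))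
      (Primrec.const _)
  obtain ⟨c, hc⟩ := kc_lemma hU hr.to_comp 8 (by
    intro n
    have := sum_unpair (f := fun a s => if P.mreq z a s then w2 (P.len (kOf a)) else 0)
      (fun a b => by split_ifs; exacts [w2_nonneg _, le_rfl]) (P.M_bound z) n
    refine le_trans (le_of_eq ?_) (this.trans (by norm_num))
    refine Finset.sum_congr rfl fun k _ => ?_
    split_ifs <;> rfl)
  refine ⟨c, fun a s h => hc (Nat.pair a s) _ _ ?_⟩
  simp only [Nat.unpair_pair]
  rw [if_pos h]

theorem N_kc {U : Str →. Str} (hU : OptimalPF U) (z : Bool) (p : ℕ) : ∃ c : ℕ, ∀ s, P.nreq z p s →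
    KC U (P.restr z s (P.out (P.pt s)).length) ≤ ((P.len (P.pt s) + p : ℕ) : ℕ∞) + c := by
  have hr : Primrec fun s : ℕ => if P.nreq z p s then
      Option.some (P.len (P.pt s) + p, P.restr z s (P.out (P.pt s)).length)
      else Option.none := 
    Primrec.ite (P.nreqP z p) (Primrec.option_some.comp (Primrec.pair
      (Primrec.nat_add.comp (P.lenP.comp P.ptP) (Primrec.const p))
      (P.pr_restr (Primrec.const z) Primrec.id (P.pr_len_out P.ptP)))) (Primrec.const _)
  obtain ⟨c, hc⟩ := kc_lemma hU hr.to_comp 2 (by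
    intro n
    refine le_trans (le_of_eq ?_) ((P.N_bound z p n).trans (by norm_num))
    refine Finset.sum_congr rfl fun k _ => ?_
    split_ifs <;> rfl)
  exact ⟨c, fun s h => hc s _ _ (by rw [if_pos h])⟩

theorem Q_kc {U : Str →. Str} (hU : OptimalPF U) : ∃ c : ℕ, ∀ u k, P.qreq u k →
    KC U (P.bs (u + 1) (P.out k).length) ≤ ((P.len k + P.pd u : ℕ) : ℕ∞) + c := by
  have hr : Primrec fun k : ℕ => if P.qreq k.unpair.1 k.unpair.2 then
      Option.some (P.len k.unpair.2 + P.pd k.unpair.1,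
        P.bs (k.unpair.1 + 1) (P.out k.unpair.2).length)
      else Option.none := by
    have h1 : Primrec fun k : ℕ => k.unpair.1 := Primrec.fst.comp Primrec.unpair
    have h2 : Primrec fun k : ℕ => k.unpair.2 := Primrec.snd.comp Primrec.unpair
    exact Primrec.ite (P.qreqP h1 h2) (Primrec.option_some.comp (Primrec.pair
      (Primrec.nat_add.comp (P.lenP.comp h2) (P.pdP.comp h1))
      (P.bsP (Primrec.succ.comp h1) (P.pr_len_out h2))))
      (Primrec.const _)
  obtain ⟨c, hc⟩ := kc_lemma hU hr.to_comp 4 (by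
    intro n
    have := sum_unpair (f := fun u k => if P.qreq u k then w2 (P.len k + P.pd u) else 0)
      (fun a b => by split_ifs; exacts [w2_nonneg _, le_rfl]) (P.Q_bound) n
    refine le_trans (le_of_eq ?_) (this.trans (by norm_num))
    refine Finset.sum_congr rfl fun k _ => ?_
    split_ifs <;> rfl)
  refine ⟨c, fun a s h => hc (Nat.pair a s) _ _ ?_⟩
  simp only [Nat.unpair_pair]
  rw [if_pos h]

end Par

/-! ### Part 9: verification -/

/-- the data of the construction are the right ones -/
structure Good (U : Str →. Str) (P : Par) (E : Bool → Set ℕ) : Prop where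
  hU : OptimalPF U
  hc0 : ∃ c0 : ℕ, ∀ k, KC U (P.out k) ≤ (P.len k : ℕ∞) + c0
  hall : ∀ σ, ∃ k, P.out k = σ ∧ KC U σ = (P.len k : ℕ∞)
  hE : ∀ z x, x ∈ E z ↔ ∃ s, P.e z s x = true

theorem restrSet_length (A : Set ℕ) (n : ℕ) : (restrSet A n).length = n := by simp [restrSet]

namespace Par
variable (P : Par)

def B : Set ℕ := Bset P.ix

theorem mem_B {u} : u ∈ P.B ↔ ∃ v, u < v ∧ P.ix v ≤ P.ix u := Iff.rfl

theorem not_B_al {u s} (h : u ∉ P.B) (hs : u < s) : P.al u s := by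
  refine ⟨hs, fun v _ huv => ?_⟩
  by_contra hc
  exact h ⟨v, huv, not_lt.1 hc⟩

theorem not_B_ch {u s} (h : u ∉ P.B) (hs : u < s) : u < P.ch s :=
  P.al_lt_ch (P.not_B_al h (by omega)) hs

theorem bs_eventually (n : ℕ) : ∃ s0, ∀ s ≥ s0, P.bs s n = restrSet P.B n := by
  induction n with
  | zero => exact ⟨0, fun s _ => rfl⟩
  | succ n ih =>
    obtain ⟨s0, h0⟩ := ih
    have h1 : ∃ s1, ∀ s ≥ s1, (n < s ∧ ¬ P.al n s) ↔ n ∈ P.B := by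
      by_cases hn : n ∈ P.B
      · obtain ⟨v, hv, hv'⟩ := P.mem_B.1 hn
        refine ⟨v + 1, fun s hs => iff_of_true ⟨by omega, fun ha => ?_⟩ hn⟩
        have := P.al_ix_lt ha (show v < s by omega) hv
        omega
      · exact ⟨0, fun s _ => iff_of_false (fun h => h.2 (P.not_B_al hn h.1)) hn⟩
    obtain ⟨s1, h1⟩ := h1
    refine ⟨max s0 s1, fun s hs => ?_⟩
    have h2 := h0 s (le_trans (le_max_left _ _) hs)
    have h3 := h1 s (le_trans (le_max_right _ _) hs)
    unfold bs restrSet at h2 ⊢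
    rw [List.range_succ, List.map_append, List.map_append, h2]
    simp only [List.map_cons, List.map_nil, h3]

variable {P} {U : Str →. Str} {E : Bool → Set ℕ}

theorem restr_eventually (G : Good U P E) (z : Bool) (n : ℕ) :
    ∃ s0, ∀ s ≥ s0, P.restr z s n = restrSet (E z) n := by
  induction n with
  | zero => exact ⟨0, fun s _ => rfl⟩
  | succ n ih =>
    obtain ⟨s0, h0⟩ := ih
    have h1 : ∃ s1, ∀ s ≥ s1, P.e z s n = decide (n ∈ E z) := by
      by_cases hn : n ∈ E z
      · obtain ⟨v, hv⟩ := (G.hE z n).1 hn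
        refine ⟨v, fun s hs => ?_⟩
        rw [P.emono z v s n hs hv]; simp [hn]
      · refine ⟨0, fun s _ => ?_⟩
        have : ¬ P.e z s n = true := fun h => hn ((G.hE z n).2 ⟨s, h⟩)
        simp [hn, this]
    obtain ⟨s1, h1⟩ := h1
    refine ⟨max s0 s1, fun s hs => ?_⟩
    have h2 := h0 s (le_trans (le_max_left _ _) hs)
    have h3 := h1 s (le_trans (le_max_right _ _) hs)
    unfold restr restrSet at h2 ⊢
    rw [List.range_succ, List.map_append, List.map_append, h2]
    simp only [List.map_cons, List.map_nil, h3]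

theorem zOf_visit (z : Bool) (k j : ℕ) : ∃ a ≥ j, zOf a = z ∧ kOf a = k := by
  refine ⟨Nat.bit z (Nat.pair k j), ?_, ?_, ?_⟩
  · have := Nat.right_le_pair k j
    cases z <;> simp [Nat.bit] <;> omega
  · unfold zOf; simp
  · unfold kOf; simp

theorem B_le (G : Good U P E) (z : Bool) : KLeSet U P.B (E z) := by
  obtain ⟨c, hc⟩ := P.M_kc G.hU z
  refine ⟨c, fun n => ?_⟩
  obtain ⟨k, hk, hlen⟩ := G.hall (restrSet (E z) n)
  have hn : (P.out k).length = n := by rw [hk, restrSet_length]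
  obtain ⟨s0, h0⟩ := restr_eventually G z n
  have hcur : ∀ s ≥ s0, P.cur z k s := fun s hs => by unfold cur; rw [hn, h0 s hs, hk]
  have hex : ∃ a, zOf a = z ∧ kOf a = k ∧ P.cur z k a := by
    obtain ⟨a, ha, h1, h2⟩ := zOf_visit z k s0
    exact ⟨a, h1, h2, hcur a ha⟩
  obtain ⟨az, ak, ac⟩ := Nat.find_spec hex
  have amin : ∀ b < Nat.find hex, ¬ (zOf b = z ∧ kOf b = k ∧ P.cur z k b) :=
    fun b hb => Nat.find_min hex hb
  generalize Nat.find hex = a at az ak ac amin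
  have hnew : P.new a := by
    refine ⟨by rw [az, ak]; exact ac, fun b hb hz hkb hcb => amin b hb ?_⟩
    rw [az] at hz hcb
    rw [ak] at hkb hcb
    exact ⟨hz, hkb, hcb⟩
  have hcur' : ∀ s ≥ a, P.cur z k s := fun s hs =>
    P.cur_between hs (le_max_left s s0) ac (hcur _ (le_max_right s s0))
  have key : ∀ d, ∃ s, P.mreq z a s ∧ P.bs (s + 1) n = P.bs (a + d + 1) n := by
    intro d
    induction d with
    | zero => exact ⟨a, ⟨le_rfl, hnew, az, by rw [ak]; exact ac, Or.inl rfl⟩, rfl⟩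
    | succ d ih =>
      obtain ⟨s, hs, hs'⟩ := ih
      by_cases h : P.bs (a + (d + 1) + 1) n = P.bs (a + (d + 1)) n
      · exact ⟨s, hs, by rw [hs', h]; rfl⟩
      · refine ⟨a + (d + 1), ⟨by omega, hnew, az, ?_, Or.inr ?_⟩, rfl⟩
        · rw [ak]; exact hcur' _ (by omega)
        · rw [ak, hn]; exact h
  obtain ⟨s1, h1⟩ := P.bs_eventually n
  obtain ⟨s, hs, hs'⟩ := key s1
  rw [h1 (a + s1 + 1) (by omega)] at hs'
  have := hc a s hs
  rw [ak, hn, hs'] at this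
  rw [hlen]; exact this

/-- the upper bound on final markers -/
theorem B_final (G : Good U P E) : ∃ c : ℕ, ∀ u, u ∉ P.B → ∀ n ≤ u,
    KC U (restrSet P.B n) ≤ KC U (zeroStr n) + ((P.pd u + c : ℕ) : ℕ∞) := by
  obtain ⟨c, hc⟩ := P.Q_kc G.hU
  refine ⟨c, fun u hu n hn => ?_⟩
  obtain ⟨k, hk, hlen⟩ := G.hall (zeroStr n)
  have hkn : (P.out k).length = n := by rw [hk]; simp [zeroStr]
  have hex : ∃ u', n ≤ u' ∧ P.pd u' = P.pd u := ⟨u, hn, rfl⟩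
  have hle : Nat.find hex ≤ u := Nat.find_min' hex ⟨hn, rfl⟩
  obtain ⟨v1, v2⟩ := Nat.find_spec hex
  have vmin : ∀ b < Nat.find hex, ¬ (n ≤ b ∧ P.pd b = P.pd u) := fun b hb => Nat.find_min hex hb
  generalize Nat.find hex = v at hle v1 v2 vmin
  have hq : P.qreq v k := by
    refine ⟨by omega, fun u' hu' hp => ?_⟩
    by_contra hcon
    exact vmin u' hu' ⟨by omega, by omega⟩
  have hstable : ∀ s, v < s → P.bs (s + 1) n = P.bs s n := by
    intro s hs
    by_contra hne
    obtain ⟨h1, h2⟩ := P.bs_change hne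
    rcases Nat.lt_or_ge u s with h3 | h3
    · have := P.not_B_ch hu h3
      omega
    · have h4 : P.al (P.ch s) (v + 1) := P.al_mono (P.act_al h1) hs (by omega)
      have h5 := P.al_ix_lt h4 (Nat.lt_succ_self v) (by omega)
      have h6 := (P.inv u).2.2.1 s (by have := P.pd_le v; omega) h3
      have h7 := (P.inv u).2.1
      have h8 := (P.inv v).2.1
      rw [v2] at h8
      have h9 := P.act_ix h1
      omega
  have hst : ∀ d, P.bs (v + 1 + d) n = P.bs (v + 1) n := by
    intro d
    induction d with
    | zero => rfl
    | succ d ih => rw [← ih]; exact hstable (v + 1 + d) (by omega)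
  obtain ⟨s1, h1⟩ := P.bs_eventually n
  have h2 := hst s1
  rw [h1 _ (by omega)] at h2
  have := hc v k hq
  rw [hkn, ← h2, v2] at this
  rw [hlen]
  refine this.trans (le_of_eq ?_)
  push_cast; ring

/-- the lower bound at final markers -/
theorem E_final (G : Good U P E) : ∃ c : ℕ, ∀ z u, u ∉ P.B → ∃ n ≤ u,
    KC U (zeroStr n) + ((2 * P.pd u : ℕ) : ℕ∞) ≤ KC U (restrSet (E z) n) + c := by
  obtain ⟨c0, hc0⟩ := G.hc0
  refine ⟨c0, fun z u hu => ?_⟩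
  choose st hst using fun n => restr_eventually G z n
  choose kk hk hlen using fun n => G.hall (restrSet (E z) n)
  set s := u + 1 + ∑ n ∈ Finset.range u, (st n + kk n + 1) with hs
  have hbig : ∀ n < u, st n + kk n + 1 ≤ s := by
    intro n hn
    have := Finset.single_le_sum (f := fun n => st n + kk n + 1) (fun i _ => Nat.zero_le _)
      (Finset.mem_range.2 hn)
    omega
  have h1 : ¬ P.wantX P.F u s z := by
    intro hX
    refine P.not_want (P.not_B_ch hu (show u < s by omega))
      ⟨P.not_B_al hu (show u < s by omega), Or.inr (Or.inl ?_)⟩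
    cases z
    · exact Or.inl hX
    · exact Or.inr hX
  unfold wantX at h1
  push Not at h1
  obtain ⟨n, hn, h2⟩ := h1
  have hb := hbig n hn
  obtain ⟨j, hj, hj1, hj2⟩ := h2 (kk n) (by omega) (by rw [hk, hst n s (by omega)])
  refine ⟨n, hn.le, ?_⟩
  rw [hlen n, ← hj1]
  have h3 : P.len j + 2 * P.pd u ≤ P.len (kk n) := hj2.le
  calc KC U (P.out j) + ((2 * P.pd u : ℕ) : ℕ∞) ≤ (P.len j + c0) + ((2 * P.pd u : ℕ) : ℕ∞) := by
        gcongr; exact hc0 j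
    _ = ((P.len j + 2 * P.pd u : ℕ) : ℕ∞) + c0 := by push_cast; ring
    _ ≤ _ := by gcongr

theorem not_le (G : Good U P E) (z : Bool) (hfin : ∀ i, ∃ u, u ∉ P.B ∧ P.ix u = i) :
    ¬ KLeSet U (E z) P.B := by
  rintro ⟨c, hc⟩
  obtain ⟨c1, h1⟩ := B_final G
  obtain ⟨c2, h2⟩ := E_final G
  obtain ⟨u, hu, hi⟩ := hfin (c + c1 + c2 + 1)
  obtain ⟨n, hn, h3⟩ := h2 z u hu
  have h4 := h1 u hu n hn
  have h5 := hc n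
  rw [← ka_eq G.hU, ← ka_eq G.hU] at h3 h4 h5
  norm_cast at h3 h4 h5
  have := P.ix_le u
  omega

/-! convergence -/

theorem ix_succ_le (u) : P.ix (u + 1) ≤ P.ix u + 1 := by
  by_cases h : P.ch (u + 1) < u + 1
  · rw [P.act_ix h]
    rcases Nat.lt_or_ge (P.ch (u + 1)) u with h1 | h1
    · have := P.al_ix_lt (P.act_al h) (Nat.lt_succ_self u) h1; omega
    · have : P.ch (u + 1) = u := by omega
      rw [this]; omega
  · rw [P.app_ix h]; simp

theorem conv_aux (G : Good U P E) (hnt : ∀ z, ¬ KTrivialSet U (E z)) (z : Bool) (p : ℕ)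
    (hinf : ∀ m, ∃ v, m ≤ P.ch v ∧ P.nreq z p v) : False := by
  have hA : ∀ k, ∃ T, ∀ u ≥ T, ∀ j < k, P.processed P.F z p j u := by
    intro k
    induction k with
    | zero => exact ⟨0, fun u _ j hj => by omega⟩
    | succ k ih =>
      obtain ⟨T, hT⟩ := ih
      obtain ⟨s0, h0⟩ := restr_eventually G z (P.out k).length
      obtain ⟨v, hv, hreq⟩ := hinf (max T s0)
      obtain ⟨hc, hz, -⟩ := P.fl_spec hreq.1
      have hp : P.pd (P.ch v) = p := by rw [← P.act_pd hc]; exact hreq.2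
      have hT' := hT (P.ch v) (le_trans (le_max_left _ _) hv)
      have hs0 : s0 ≤ P.ch v := le_trans (le_max_right _ _) hv
      have hge : k ≤ P.ti z (P.ch v) := by
        by_contra hcon
        have := P.ti_spec z (P.ch v)
        rw [hp] at this
        exact this (hT' _ (by omega))
      refine ⟨v, fun u hu j hj => ?_⟩
      rcases Nat.lt_or_ge j k with h1 | h1
      · exact hT u (by have := le_trans (le_max_left _ _) hv; omega) j h1
      · have hjk : j = k := by omega
        subst hjk
        rcases hge.lt_or_eq with h2 | h2
        · obtain ⟨s', a1, a2, a3, a4, a5⟩ := P.ti_min h2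
          refine ⟨s', by omega, a2, a3.trans hp, a4, ?_⟩
          rw [a5, h0 _ hs0, h0 u (by omega)]
        · refine ⟨v, by omega, hreq.1, hreq.2, ?_, ?_⟩
          · change P.pt v = j
            rw [P.act_pt hc, hz, ← h2]
          · rw [h0 v (by omega), h0 u (by omega)]
  obtain ⟨c, hc⟩ := P.N_kc G.hU z p
  refine hnt z ⟨p + c, fun n => ?_⟩
  obtain ⟨k, hk, hlen⟩ := G.hall (zeroStr n)
  have hkn : (P.out k).length = n := by rw [hk]; simp [zeroStr]
  obtain ⟨T, hT⟩ := hA (k + 1)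
  obtain ⟨s0, h0⟩ := restr_eventually G z n
  obtain ⟨s', a1, a2, a3, a4, a5⟩ := hT (max T s0) (le_max_left _ _) k (Nat.lt_succ_self k)
  have h1 := hc s' ⟨a2, a3⟩
  have a4' : P.pt s' = k := a4
  rw [a4', a5, hkn, h0 _ (le_max_right _ _)] at h1
  rw [hlen]
  refine h1.trans (le_of_eq ?_)
  push_cast; ring

theorem conv (G : Good U P E) (hnt : ∀ z, ¬ KTrivialSet U (E z)) (i : ℕ) :
    ∃ s0, ∀ v ≥ s0, i ≤ P.ix v := by
  induction i with
  | zero => exact ⟨0, fun v _ => Nat.zero_le _⟩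
  | succ i ih =>
    obtain ⟨s0, h0⟩ := ih
    by_contra hcon
    push Not at hcon
    have hI : ∀ m, ∃ v ≥ m, P.ix v = i := by
      intro m
      obtain ⟨v, hv, hv'⟩ := hcon (max m s0)
      have := h0 v (le_trans (le_max_right _ _) hv)
      exact ⟨v, le_trans (le_max_left _ _) hv, by omega⟩
    obtain ⟨v0, hv0, hi0⟩ := hI s0
    -- all later markers are inherited from `v0`
    have hact : ∀ v, v0 < v → P.ix v = i → P.ch v < v ∧ P.ix (P.ch v) = i ∧
        ∀ w, w < v → P.ix w = i → w ≤ P.ch v := by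
      intro v hv hvi
      have h1 : P.ch v < v := by
        by_contra hc
        rw [P.app_ix hc, if_neg (by omega)] at hvi
        have := h0 (v - 1) (by omega)
        omega
      have h2 : P.ix (P.ch v) = i := by rw [← P.act_ix h1]; exact hvi
      refine ⟨h1, h2, fun w hw hwi => ?_⟩
      by_contra hc
      have := P.al_ix_lt (P.act_al h1) hw (by omega)
      omega
    have hpd : ∀ v, v0 ≤ v → P.ix v = i → P.pd v = P.pd v0 := by
      intro v
      induction v using Nat.strong_induction_on with
      | _ v ihv =>
        intro hv hvi
        rcases hv.lt_or_eq with h | h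
        · obtain ⟨h1, h2, h3⟩ := hact v h hvi
          rw [P.act_pd h1]
          exact ihv _ h1 (h3 v0 h hi0) h2
        · rw [h]
    set p := P.pd v0 with hp
    have hlarge : ∀ m, ∃ M, ∀ v ≥ M, P.ix v = i → m ≤ P.ch v := by
      intro m
      obtain ⟨w, hw, hwi⟩ := hI (max m v0)
      refine ⟨w + 1, fun v hv hvi => ?_⟩
      have := (hact v (by have := le_trans (le_max_right _ _) hw; omega) hvi).2.2 w (by omega) hwi
      exact le_trans (le_trans (le_max_left _ _) hw) this
    -- no `X` after some stage
    have hX : ∀ z, ∃ M, ∀ v ≥ M, P.ix v = i → ¬ P.wantX P.F (P.ch v) v z := by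
      intro z
      obtain ⟨c0, hc0⟩ := G.hc0
      have h1 := hnt z
      unfold KTrivialSet at h1
      push Not at h1
      obtain ⟨n, hn⟩ := h1 (2 * p + c0)
      obtain ⟨j, hj, hjl⟩ := G.hall (zeroStr n)
      obtain ⟨s1, h1⟩ := restr_eventually G z n
      obtain ⟨M, hM⟩ := hlarge (n + 1)
      refine ⟨M + s1 + j + v0 + 1, fun v hv hvi hX => ?_⟩
      obtain ⟨k, hk, hk1, hk2⟩ := hX n (hM v (by omega) hvi)
      have h2 := hk2 j (by omega) hj
      have h3 : (P.F (P.ch v)).2.1 = p := by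
        obtain ⟨b1, b2, b3⟩ := hact v (by omega) hvi
        exact hpd _ (b3 v0 (by omega) hi0) b2
      rw [h3] at h2
      rw [h1 v (by omega)] at hk1
      have h4 := hc0 k
      rw [hk1] at h4
      refine absurd hn (not_lt.2 (h4.trans ?_))
      rw [hjl]
      norm_cast
      omega
    have hH : ∃ M, ∀ v ≥ M, P.ix v = i → ¬ wantH P.F (P.ch v) v := by
      by_cases h : i ∈ haltingSet
      · obtain ⟨s, hs⟩ := (mem_halting_iff i).1 h
        obtain ⟨M, hM⟩ := hlarge s
        refine ⟨M + v0 + 1, fun v hv hvi hw => ?_⟩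
        have h1 : (P.F (P.ch v)).1 = i := (hact v (by omega) hvi).2.1
        have h2 := hw.1
        rw [h1, hal_mono (hM v (by omega) hvi) hs] at h2
        exact absurd h2 (by decide)
      · refine ⟨v0 + 1, fun v hv hvi hw => h ?_⟩
        have h1 : (P.F (P.ch v)).1 = i := (hact v (by omega) hvi).2.1
        have h2 := hw.2
        rw [h1] at h2
        exact (mem_halting_iff i).2 ⟨v, h2⟩
    obtain ⟨M1, hM1⟩ := hX false
    obtain ⟨M2, hM2⟩ := hX true
    obtain ⟨M3, hM3⟩ := hH
    have hT : ∀ v ≥ M1 + M2 + M3 + v0 + 1, P.ix v = i → P.nreq (zOf v) p v := by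
      intro v hv hvi
      obtain ⟨b1, b2, b3⟩ := hact v (by omega) hvi
      have hw : P.wantT P.F (P.ch v) v := by
        rcases (P.act_want b1).2 with h | (h | h) | h
        · exact absurd h (hM3 v (by omega) hvi)
        · exact absurd h (hM1 v (by omega) hvi)
        · exact absurd h (hM2 v (by omega) hvi)
        · exact h
      refine ⟨?_, hpd v (by omega) hvi⟩
      rw [P.act_fl b1, if_pos hw]
    have hpig : ∃ z, ∀ m, ∃ v ≥ m, P.ix v = i ∧ zOf v = z := by
      by_contra hc
      push Not at hc
      obtain ⟨m1, h1⟩ := hc true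
      obtain ⟨m2, h2⟩ := hc false
      obtain ⟨v, hv, hvi⟩ := hI (m1 + m2)
      have h3 := h1 v (by omega) hvi
      have h4 := h2 v (by omega) hvi
      cases h : zOf v <;> simp_all
    obtain ⟨z, hz⟩ := hpig
    refine conv_aux G hnt z p fun m => ?_
    obtain ⟨M, hM⟩ := hlarge m
    obtain ⟨v, hv, hvi, hvz⟩ := hz (M + (M1 + M2 + M3 + v0 + 1))
    exact ⟨v, hM v (by omega) hvi, hvz ▸ hT v (by omega) hvi⟩

theorem final (G : Good U P E) (hnt : ∀ z, ¬ KTrivialSet U (E z)) (i : ℕ) :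
    ∃ u, u ∉ P.B ∧ P.ix u = i := by
  obtain ⟨s0, h0⟩ := conv G hnt (i + 1)
  have hix0 : P.ix 0 ≤ i := by have := P.ix_le 0; have := P.pd_le 0; omega
  set u := Nat.findGreatest (fun v => P.ix v ≤ i) s0 with hu
  have h1 : P.ix u ≤ i := Nat.findGreatest_spec (P := fun v => P.ix v ≤ i) (Nat.zero_le s0) hix0
  have h2 : ∀ v, u < v → i < P.ix v := by
    intro v hv
    by_cases hvs : v ≤ s0
    · have := Nat.findGreatest_is_greatest (P := fun v => P.ix v ≤ i) hv hvs
      omega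
    · have := h0 v (by omega); omega
  have h3 : P.ix u = i := by
    have := h2 (u + 1) (by omega)
    have := P.ix_succ_le u
    omega
  refine ⟨u, ?_, h3⟩
  rintro ⟨v, hv, hv'⟩
  have := h2 v hv
  omega

theorem main (G : Good U P E) (hnt : ∀ z, ¬ KTrivialSet U (E z)) :
    CESet P.B ∧ (∀ z, KLtSet U P.B (E z)) ∧ TuringEquivSet P.B haltingSet := by
  have hfin := final G hnt
  refine ⟨Bset_ce P.ixP, fun z => ⟨B_le G z, not_le G z hfin⟩,
    ce_le_halting (Bset_ce P.ixP), halting_le_Bset P.ixP ?_ hfin⟩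
  intro u hu hh
  by_contra hc
  obtain ⟨s, hs⟩ := (mem_halting_iff _).1 hh
  refine P.not_want (P.not_B_ch hu (show u < s + u + 1 by omega))
    ⟨P.not_B_al hu (by omega), Or.inl ⟨(Bool.not_eq_true _).mp hc, hal_mono (by omega) hs⟩⟩

end Par

/-! ### Part 10: conclusion -/

theorem ce_approx {A : Set ℕ} (hA : CESet A) : ∃ c : Nat.Partrec.Code,
    ∀ x, x ∈ A ↔ ∃ s, (Nat.Partrec.Code.evaln s c x).isSome = true := by
  obtain ⟨f, hf, h⟩ := hA
  obtain ⟨c, rfl⟩ := Nat.Partrec.Code.exists_code.1 hf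
  refine ⟨c, fun x => ?_⟩
  rw [h x, Part.dom_iff_mem]
  constructor
  · rintro ⟨y, hy⟩
    obtain ⟨k, hk⟩ := Nat.Partrec.Code.evaln_complete.1 hy
    exact ⟨k, Option.isSome_iff_exists.2 ⟨y, hk⟩⟩
  · rintro ⟨s, hs⟩
    obtain ⟨y, hy⟩ := Option.isSome_iff_exists.1 hs
    exact ⟨y, Nat.Partrec.Code.evaln_sound hy⟩

/-- Let `A`, `D` be computably enumerable sets, neither `K`-trivial.
Then there is a c.e. set `B` with `B <_K A`, `B <_K D` and `B ≡_T ∅'`. -/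
theorem stmt1 (U : Str →. Str) (hU : OptimalPF U)
    (A D : Set ℕ) (hA : CESet A) (hD : CESet D)
    (hAnt : ¬ KTrivialSet U A) (hDnt : ¬ KTrivialSet U D) :
    ∃ B : Set ℕ, CESet B ∧ KLtSet U B A ∧ KLtSet U B D ∧
      TuringEquivSet B haltingSet := by
  obtain ⟨cA, hcA⟩ := ce_approx hA
  obtain ⟨cD, hcD⟩ := ce_approx hD
  obtain ⟨len, out, h1, h2, h3, h4, h5, h6, h7⟩ := exists_enum hU
  let P : Par :=
    { len := len
      out := out
      e := fun z s x => (Nat.Partrec.Code.evaln s (cond z cD cA) x).isSome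
      lenP := h1
      outP := h2
      eP := by
        refine Primrec.option_isSome.comp (Nat.Partrec.Code.primrec_evaln.comp (Primrec.pair
          (Primrec.pair (Primrec.fst.comp Primrec.snd)
            (Primrec.cond Primrec.fst (Primrec.const cD) (Primrec.const cA)))
          (Primrec.snd.comp Primrec.snd)))
      hout := h3
      hlen := h4
      hsum := h5
      emono := by
        intro z s t x hst h
        obtain ⟨y, hy⟩ := Option.isSome_iff_exists.1 h
        exact Option.isSome_iff_exists.2 ⟨y, Nat.Partrec.Code.evaln_mono hst hy⟩ }
  have G : Good U P (fun z => cond z D A) :=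
    { hU := hU
      hc0 := h6
      hall := h7
      hE := by
        intro z x
        cases z
        · exact hcA x
        · exact hcD x }
  obtain ⟨m1, m2, m3⟩ := Par.main G (by intro z; cases z; exacts [hAnt, hDnt])
  exact ⟨P.B, m1, m2 false, m2 true, m3⟩


end KPaper
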